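/- arXiv:0809.1391 — 2 statements merged into one kernel-verified Lean document; each statement's English description precedes it below -/
import Mathlib

section
/- For every g ∈ {1, 2, 3} and every τ ∈ ℍ_g, the cosmological constant vanishes identically: Ξ^{(g)}(τ) = 0. -/
open scoped BigOperators

noncomputable section

/-- The Siegel upper half-space: symmetric complex matrices with positive
definite imaginary part (indexed by a finite type `ι`). -/
def Siegel (ι : Type) [Fintype ι] : Set (Matrix ι ι ℂ) :=
  {τ | τ.IsSymm ∧ ∀ v : ι → ℝ, v ≠ 0 → 0 < ∑ i, ∑ j, v i * (τ i j).im * v j}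

/-- The theta function with characteristic `[ε, δ]`. -/
def theta {ι : Type} [Fintype ι] (ε δ : ι → ZMod 2) (τ : Matrix ι ι ℂ) (z : ι → ℂ) : ℂ :=
  ∑' n : ι → ℤ, Complex.exp ((Real.pi : ℂ) * Complex.I *
    ((∑ i, ∑ j, ((n i : ℂ) + ((ε i).val : ℂ) / 2) * τ i j * ((n j : ℂ) + ((ε j).val : ℂ) / 2)) +
     2 * ∑ i, ((n i : ℂ) + ((ε i).val : ℂ) / 2) * (z i + ((δ i).val : ℂ) / 2)))

/-- A theta characteristic, an element of `𝔽₂^{2g}`. -/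
abbrev Char2 (ι : Type) := (ι → ZMod 2) × (ι → ZMod 2)

/-- Theta function, with the characteristic as a pair. -/
def thetaChar {ι : Type} [Fintype ι] (m : Char2 ι) (τ : Matrix ι ι ℂ) (z : ι → ℂ) : ℂ :=
  theta m.1 m.2 τ z

/-- Theta constant. -/
def thetaConst {ι : Type} [Fintype ι] (m : Char2 ι) (τ : Matrix ι ι ℂ) : ℂ :=
  thetaChar m τ 0

/-- `W` is (the underlying finite set of) an `i`-dimensional affine subspace of `𝔽₂^{2g}`,
i.e. a coset of an `i`-dimensional linear subspace. -/
def IsAffineCosetDim {ι : Type} [Fintype ι] (i : ℕ) (W : Finset (Char2 ι)) : Prop :=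
  ∃ (V : Submodule (ZMod 2) (Char2 ι)) (x : Char2 ι),
    Module.finrank (ZMod 2) V = i ∧ (W : Set (Char2 ι)) = (fun v => x + v) '' (V : Set (Char2 ι))

/-- The modular form `S_{i,s}^g(τ) = Σ_W (Π_{w∈W} θ_w(τ))^s`, the sum over all
`i`-dimensional affine subspaces `W` of `𝔽₂^{2g}`, each counted once. -/
noncomputable def Sform (ι : Type) [Fintype ι] (i s : ℕ) (τ : Matrix ι ι ℂ) : ℂ :=
  letI := Classical.propDecidable
  ∑ W ∈ Finset.univ.filter (fun W : Finset (Char2 ι) => IsAffineCosetDim i W),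
    (∏ w ∈ W, thetaConst w τ) ^ s

/-- The cosmological constant
`Ξ^{(g)}(τ) = 2^{−g}·Σ_{i=0}^g (−1)^i·2^{i(i+1)/2}·S_{i,2^{4−i}}^g(τ)`. -/
noncomputable def XiCosm (ι : Type) [Fintype ι] (τ : Matrix ι ι ℂ) : ℂ :=
  (2 : ℂ)⁻¹ ^ Fintype.card ι * ∑ i ∈ Finset.range (Fintype.card ι + 1),
    (-1 : ℂ) ^ i * 2 ^ (i * (i + 1) / 2) * Sform ι i (2 ^ (4 - i)) τ

namespace Cosmological

open Finset Module

section Cosets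

variable {E : Type*} [AddCommGroup E] [Module (ZMod 2) E]

theorem add_self_eq_zero_of_zmod_two (x : E) :
    x + x = 0 := by
  rw [← two_smul (ZMod 2) x, show (2 : ZMod 2) = 0 from rfl, zero_smul]

theorem mem_sup_span_singleton_zmod_two {V : Submodule (ZMod 2) E} {c v : E} :
    v ∈ V ⊔ Submodule.span (ZMod 2) {c} ↔ v ∈ V ∨ v + c ∈ V := by
  rw [Submodule.mem_sup]
  constructor
  · rintro ⟨y, hy, z, hz, rfl⟩
    obtain ⟨a, rfl⟩ := Submodule.mem_span_singleton.1 hz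
    fin_cases a
    · left
      change y + (0 : ZMod 2) • c ∈ V
      simpa using hy
    · right
      change y + (1 : ZMod 2) • c + c ∈ V
      simpa [add_assoc, add_self_eq_zero_of_zmod_two] using hy
  · rintro (hv | hv)
    · exact ⟨v, hv, 0, zero_mem _, add_zero _⟩
    · exact ⟨v + c, hv, c, Submodule.mem_span_singleton_self c, by
        simp [add_assoc, add_self_eq_zero_of_zmod_two]⟩

theorem sup_span_singleton_of_mem {V : Submodule (ZMod 2) E} {c : E} (hc : c ∈ V) :
    V ⊔ Submodule.span (ZMod 2) {c} = V :=
  sup_eq_left.2 ((Submodule.span_singleton_le_iff_mem c V).2 hc)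

/-- The subspace obtained from `⊥` by adjoining the entries of a list, the head last. -/
def listSpan : List E → Submodule (ZMod 2) E
  | [] => ⊥
  | c :: l => listSpan l ⊔ Submodule.span (ZMod 2) {c}

theorem listSpan_cons_of_mem {c : E} {l : List E} (hc : c ∈ listSpan l) :
    listSpan (c :: l) = listSpan l :=
  sup_span_singleton_of_mem hc

variable [Fintype E]

open scoped Classical in
/-- The product of `h` over the coset `m + V`. -/
def cosetProd (h : E → ℂ) (V : Submodule (ZMod 2) E) (m : E) : ℂ :=
  ∏ v ∈ univ.filter (· ∈ V), h (m + v)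

/-- The product of `h` over the `2 ^ l.length` subset sums of `l`, translated by `m`. -/
def cubeProd (h : E → ℂ) : List E → E → ℂ
  | [], m => h m
  | c :: l, m => cubeProd h l m * cubeProd h l (m + c)

/-- The sum of `F` over the subspaces generated by `V` and `r` further vectors. -/
def tupleSum (F : Submodule (ZMod 2) E → ℂ) : ℕ → Submodule (ZMod 2) E → ℂ
  | 0, V => F V
  | r + 1, V => ∑ c : E, tupleSum F r (V ⊔ Submodule.span (ZMod 2) {c})

open scoped Classical in
/-- The sum of `tupleSum F r` over the spans of linearly independent `j`-tuples. -/
def indepSum (F : Submodule (ZMod 2) E → ℂ) (j r : ℕ) : ℂ :=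
  ∑ b ∈ univ.filter (fun b : Fin j → E => LinearIndependent (ZMod 2) b),
    tupleSum F r (Submodule.span (ZMod 2) (Set.range b))

/-- The sum over `m` of the products over `m + V`, with total degree `16` when `dim V ≤ 4`. -/
def cosetSum (h : E → ℂ) (V : Submodule (ZMod 2) E) : ℂ :=
  ∑ m : E, cosetProd h V m ^ 2 ^ (4 - finrank (ZMod 2) V)

theorem cosetProd_add_of_mem (h : E → ℂ) {V : Submodule (ZMod 2) E} {c : E} (hc : c ∈ V) (m : E) :
    cosetProd h V (m + c) = cosetProd h V m := by
  classical
  unfold cosetProd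
  refine Finset.prod_equiv (Equiv.addLeft c) (fun v => ?_) (fun v _ => ?_)
  · simp [Submodule.add_mem_iff_right V hc]
  · simp [add_assoc]

theorem cosetProd_sup_of_notMem (h : E → ℂ) {V : Submodule (ZMod 2) E} {c : E} (hc : c ∉ V)
    (m : E) : cosetProd h (V ⊔ Submodule.span (ZMod 2) {c}) m =
      cosetProd h V m * cosetProd h V (m + c) := by
  classical
  have hsplit : univ.filter (· ∈ V ⊔ Submodule.span (ZMod 2) {c}) =
      univ.filter (· ∈ V) ∪ univ.filter (· + c ∈ V) := by
    ext v; simp [mem_sup_span_singleton_zmod_two]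
  have hdisj : Disjoint (univ.filter (· ∈ V)) (univ.filter (· + c ∈ V)) := by
    rw [Finset.disjoint_filter]
    intro v _ hv hvc
    exact hc ((Submodule.add_mem_iff_right V hv).1 hvc)
  unfold cosetProd
  rw [hsplit, Finset.prod_union hdisj]
  congr 1
  refine Finset.prod_equiv (Equiv.addRight c) (fun v => ?_) (fun v _ => ?_)
  · simp
  · simp only [Equiv.coe_addRight]
    congr 1
    rw [add_assoc, add_comm v c, ← add_assoc c, add_self_eq_zero_of_zmod_two, zero_add]

theorem finrank_sup_of_notMem {V : Submodule (ZMod 2) E} {c : E} (hc : c ∉ V) :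
    finrank (ZMod 2) ↥(V ⊔ Submodule.span (ZMod 2) {c}) = finrank (ZMod 2) V + 1 := by
  have hc0 : c ≠ 0 := fun h0 => hc (h0 ▸ zero_mem V)
  have hinf : V ⊓ Submodule.span (ZMod 2) {c} = ⊥ :=
    ((Submodule.disjoint_span_singleton' hc0).2 hc).eq_bot
  have := Submodule.finrank_sup_add_finrank_inf_eq V (Submodule.span (ZMod 2) {c})
  rw [hinf, finrank_bot, finrank_span_singleton hc0] at this
  simpa using this

theorem finrank_listSpan_cons_of_notMem {c : E} {l : List E} (hc : c ∉ listSpan l) :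
    finrank (ZMod 2) (listSpan (c :: l)) = finrank (ZMod 2) (listSpan l) + 1 :=
  finrank_sup_of_notMem hc

theorem finrank_listSpan_le (l : List E) : finrank (ZMod 2) (listSpan l) ≤ l.length := by
  induction l with
  | nil => exact (finrank_bot (ZMod 2) E).le
  | cons c l ih =>
    by_cases hc : c ∈ listSpan l
    · rw [listSpan_cons_of_mem hc, List.length_cons]; omega
    · rw [finrank_listSpan_cons_of_notMem hc, List.length_cons]; omega

theorem cubeProd_eq_cosetProd_pow (h : E → ℂ) (l : List E) (m : E) :
    cubeProd h l m =
      cosetProd h (listSpan l) m ^ 2 ^ (l.length - finrank (ZMod 2) (listSpan l)) := by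
  induction l generalizing m with
  | nil =>
    classical
    simp only [cubeProd, cosetProd, listSpan, List.length_nil, Nat.zero_sub, pow_zero, pow_one]
    rw [Finset.prod_eq_single 0] <;> simp +contextual
  | cons c l ih =>
    have hle := finrank_listSpan_le l
    rw [cubeProd, ih, ih, ← mul_pow]
    by_cases hc : c ∈ listSpan l
    · rw [listSpan_cons_of_mem hc, List.length_cons, cosetProd_add_of_mem h hc, Nat.succ_sub hle,
        pow_succ' 2, pow_mul, sq]
    · rw [finrank_listSpan_cons_of_notMem hc, List.length_cons, Nat.add_sub_add_right, listSpan,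
        cosetProd_sup_of_notMem h hc]

theorem cosetSum_listSpan (h : E → ℂ) (l : List E) (hl : l.length ≤ 4) :
    cosetSum h (listSpan l) = ∑ m : E, cubeProd h l m ^ 2 ^ (4 - l.length) := by
  have hle := finrank_listSpan_le l
  refine Finset.sum_congr rfl fun m _ => ?_
  rw [cubeProd_eq_cosetProd_pow, ← pow_mul, ← pow_add]
  congr 2
  omega

theorem card_filter_mem (V : Submodule (ZMod 2) E) [DecidablePred (· ∈ V)] :
    (univ.filter (· ∈ V)).card = 2 ^ finrank (ZMod 2) V := by
  classical
  have := Module.card_eq_pow_finrank (K := ZMod 2) (V := V)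
  rw [ZMod.card] at this
  rw [← this, Fintype.card_subtype]

theorem indepSum_succ (F : Submodule (ZMod 2) E → ℂ) (j r : ℕ) :
    indepSum F j (r + 1) = 2 ^ j * indepSum F j r + indepSum F (j + 1) r := by
  classical
  have hsucc : indepSum F (j + 1) r =
      ∑ b ∈ univ.filter (fun b : Fin j → E => LinearIndependent (ZMod 2) b),
        ∑ c ∈ univ.filter (fun c => c ∉ Submodule.span (ZMod 2) (Set.range b)),
          tupleSum F r (Submodule.span (ZMod 2) (Set.range b) ⊔ Submodule.span (ZMod 2) {c}) := by
    unfold indepSum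
    simp only [Finset.sum_filter]
    rw [← (Fin.consEquiv (fun _ : Fin (j + 1) => E)).sum_comp, Fintype.sum_prod_type,
      Finset.sum_comm]
    refine Finset.sum_congr rfl fun b _ => ?_
    by_cases hb : LinearIndependent (ZMod 2) b
    · simp only [hb, if_true]
      refine Finset.sum_congr rfl fun c _ => ?_
      simp only [Fin.consEquiv, Equiv.coe_fn_mk, linearIndependent_finCons, hb, true_and,
        Fin.range_cons, Submodule.span_insert, sup_comm]
    · simp [Fin.consEquiv, linearIndependent_finCons, hb]
  rw [hsucc, indepSum, indepSum, Finset.mul_sum, ← Finset.sum_add_distrib]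
  refine Finset.sum_congr rfl fun b hb => ?_
  have hb : LinearIndependent (ZMod 2) b := (Finset.mem_filter.1 hb).2
  rw [tupleSum, ← Finset.sum_filter_add_sum_filter_not univ
    (fun c => c ∈ Submodule.span (ZMod 2) (Set.range b))]
  congr 1
  rw [Finset.sum_congr rfl (g := fun _ => tupleSum F r (Submodule.span (ZMod 2) (Set.range b)))
    fun c hc => by rw [sup_span_singleton_of_mem (Finset.mem_filter.1 hc).2]]
  rw [Finset.sum_const, card_filter_mem, finrank_span_eq_card hb, Fintype.card_fin, nsmul_eq_mul]
  push_cast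
  rfl

theorem indepSum_zero_left (F : Submodule (ZMod 2) E → ℂ) (r : ℕ) :
    indepSum F 0 r = tupleSum F r ⊥ := by
  classical
  simp [indepSum]

theorem card_linearIndependent_mem (V : Submodule (ZMod 2) E)
    [DecidablePred fun b : Fin (finrank (ZMod 2) V) → E =>
      LinearIndependent (ZMod 2) b ∧ ∀ i, b i ∈ V] :
    (univ.filter (fun b : Fin (finrank (ZMod 2) V) → E =>
      LinearIndependent (ZMod 2) b ∧ ∀ i, b i ∈ V)).card =
      ∏ i : Fin (finrank (ZMod 2) V), (2 ^ finrank (ZMod 2) V - 2 ^ i.val) := by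
  classical
  have hcard := card_linearIndependent (K := ZMod 2) (V := V) (le_refl _)
  rw [ZMod.card] at hcard
  rw [← hcard, ← Fintype.card_subtype, ← Nat.card_eq_fintype_card]
  refine Nat.card_congr
    { toFun := fun b => ⟨fun i => ⟨b.1 i, b.2.2 i⟩, ?_⟩
      invFun := fun s => ⟨fun i => (s.1 i : E), ?_, fun i => (s.1 i).2⟩
      left_inv := fun b => rfl
      right_inv := fun s => rfl }
  · exact LinearIndependent.of_comp V.subtype b.2.1
  · exact s.2.map' V.subtype (Submodule.ker_subtype V)

end Cosets

section AffineSubspaces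

variable {ι : Type} [Fintype ι] [DecidableEq ι]

theorem card_of_isAffineCosetDim {j : ℕ} {W : Finset (Char2 ι)} (hW : IsAffineCosetDim j W) :
    W.card = 2 ^ j := by
  classical
  obtain ⟨V, x, rfl, hWV⟩ := hW
  have : W = (univ.filter (· ∈ V)).image (fun v => x + v) := by
    apply Finset.coe_injective
    rw [hWV]
    simp
  rw [this, Finset.card_image_of_injective _ (add_right_injective x), card_filter_mem]

open scoped Classical in
/-- The coset `m + V` as a finite set. -/
def cosetFinset (V : Submodule (ZMod 2) (Char2 ι)) (m : Char2 ι) : Finset (Char2 ι) :=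
  (univ.filter (· ∈ V)).image (fun v => m + v)

theorem coe_cosetFinset (V : Submodule (ZMod 2) (Char2 ι)) (m : Char2 ι) :
    (cosetFinset V m : Set (Char2 ι)) = (fun v => m + v) '' (V : Set (Char2 ι)) := by
  simp [cosetFinset]

theorem prod_cosetFinset (h : Char2 ι → ℂ) (V : Submodule (ZMod 2) (Char2 ι)) (m : Char2 ι) :
    ∏ w ∈ cosetFinset V m, h w = cosetProd h V m := by
  classical
  rw [cosetFinset, Finset.prod_image fun _ _ _ _ hab => add_right_injective m hab, cosetProd]

theorem mem_cosetFinset {V : Submodule (ZMod 2) (Char2 ι)} {m w : Char2 ι} :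
    w ∈ cosetFinset V m ↔ w - m ∈ V := by
  rw [← Finset.mem_coe, coe_cosetFinset]
  constructor
  · rintro ⟨v, hv, rfl⟩
    simpa using hv
  · intro hw
    exact ⟨w - m, hw, by simp⟩

theorem cosetFinset_eq_iff {U V : Submodule (ZMod 2) (Char2 ι)} {m x : Char2 ι} :
    cosetFinset U m = cosetFinset V x ↔ U = V ∧ m ∈ cosetFinset V x := by
  constructor
  · intro h
    have hm : m - x ∈ V := mem_cosetFinset.1 (h ▸ mem_cosetFinset.2 (by simp))
    refine ⟨?_, mem_cosetFinset.2 hm⟩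
    ext u
    have hu := (Finset.ext_iff.1 h) (m + u)
    rw [mem_cosetFinset, mem_cosetFinset, add_sub_cancel_left, add_sub_right_comm,
      Submodule.add_mem_iff_right V hm] at hu
    exact hu
  · rintro ⟨rfl, hm⟩
    rw [mem_cosetFinset] at hm
    ext w
    rw [mem_cosetFinset, mem_cosetFinset, ← Submodule.add_mem_iff_left U hm]
    simp

theorem card_fiber_cosetFinset {j : ℕ} {W : Finset (Char2 ι)} (hW : IsAffineCosetDim j W)
    [DecidablePred fun p : (Fin j → Char2 ι) × Char2 ι => LinearIndependent (ZMod 2) p.1 ∧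
      cosetFinset (Submodule.span (ZMod 2) (Set.range p.1)) p.2 = W] :
    (univ.filter fun p : (Fin j → Char2 ι) × Char2 ι => LinearIndependent (ZMod 2) p.1 ∧
      cosetFinset (Submodule.span (ZMod 2) (Set.range p.1)) p.2 = W).card =
      (∏ i : Fin j, (2 ^ j - 2 ^ i.val)) * 2 ^ j := by
  classical
  have hcard := card_of_isAffineCosetDim hW
  obtain ⟨V, x, rfl, hWV⟩ := hW
  rw [← coe_cosetFinset, Finset.coe_inj] at hWV
  rw [← card_linearIndependent_mem V, ← hcard, ← Finset.card_product]
  congr 1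
  ext ⟨b, m⟩
  simp only [Finset.mem_filter, Finset.mem_univ, true_and, Finset.mem_product, hWV,
    cosetFinset_eq_iff, and_assoc, and_congr_right_iff]
  intro hb
  refine and_congr_left fun _ => ⟨?_, fun hbV => ?_⟩
  · intro hspan i
    rw [← hspan]
    exact Submodule.subset_span ⟨i, rfl⟩
  · refine Submodule.eq_of_le_of_finrank_eq (Submodule.span_le.2 ?_) ?_
    · rintro _ ⟨i, rfl⟩
      exact hbV i
    · rw [finrank_span_eq_card hb, Fintype.card_fin]

theorem indepSum_cosetSum_zero_right (j : ℕ) (τ : Matrix ι ι ℂ) :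
    indepSum (cosetSum fun m : Char2 ι => thetaConst m τ) j 0 =
      ((∏ i : Fin j, (2 ^ j - 2 ^ i.val) : ℕ) * 2 ^ j : ℂ) * Sform ι j (2 ^ (4 - j)) τ := by
  classical
  set s := univ.filter fun p : (Fin j → Char2 ι) × Char2 ι => LinearIndependent (ZMod 2) p.1
    with hs
  set T := univ.filter fun W : Finset (Char2 ι) => IsAffineCosetDim j W with hT
  have hS : Sform ι j (2 ^ (4 - j)) τ = ∑ W ∈ T, (∏ w ∈ W, thetaConst w τ) ^ 2 ^ (4 - j) := by
    unfold Sform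
    refine Finset.sum_congr ?_ fun _ _ => rfl
    ext; simp [hT]
  have hI : indepSum (cosetSum fun m : Char2 ι => thetaConst m τ) j 0 = ∑ p ∈ s,
      (∏ w ∈ cosetFinset (Submodule.span (ZMod 2) (Set.range p.1)) p.2, thetaConst w τ) ^
        2 ^ (4 - j) := by
    rw [hs, ← Finset.univ_product_univ, indepSum]
    have : ((univ ×ˢ univ).filter fun p : (Fin j → Char2 ι) × Char2 ι =>
        LinearIndependent (ZMod 2) p.1) =
        (univ.filter fun b : Fin j → Char2 ι => LinearIndependent (ZMod 2) b) ×ˢ univ := by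
      ext; simp
    rw [this, Finset.sum_product]
    refine Finset.sum_congr (by ext; simp) fun b hb => ?_
    have hb : LinearIndependent (ZMod 2) b := (Finset.mem_filter.1 hb).2
    simp only [tupleSum, cosetSum, prod_cosetFinset, finrank_span_eq_card hb, Fintype.card_fin]
  have hmaps : ∀ p ∈ s, cosetFinset (Submodule.span (ZMod 2) (Set.range p.1)) p.2 ∈ T := by
    intro p hp
    have hb : LinearIndependent (ZMod 2) p.1 := (Finset.mem_filter.1 hp).2
    refine Finset.mem_filter.2 ⟨Finset.mem_univ _, _, p.2, ?_, coe_cosetFinset _ _⟩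
    rw [finrank_span_eq_card hb, Fintype.card_fin]
  rw [hI, hS, ← Finset.sum_fiberwise_of_maps_to' hmaps
    (fun W => (∏ w ∈ W, thetaConst w τ) ^ 2 ^ (4 - j)), Finset.mul_sum]
  refine Finset.sum_congr rfl fun W hW => ?_
  rw [Finset.sum_const, hs, Finset.filter_filter,
    card_fiber_cosetFinset (Finset.mem_filter.1 hW).2, nsmul_eq_mul]
  push_cast
  rfl

end AffineSubspaces

section Fourier

/-- The nontrivial character of `𝔽₂`. -/
def sgn (x : ZMod 2) : ℂ := if x = 0 then 1 else -1

theorem sgn_zero : sgn 0 = 1 := rfl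

theorem sgn_eq_intCast (x : ZMod 2) : sgn x = ((if x = 0 then 1 else -1 : ℤ) : ℂ) := by
  unfold sgn; split_ifs <;> simp

theorem sgn_one : sgn 1 = -1 := rfl

theorem sgn_add (x y : ZMod 2) : sgn (x + y) = sgn x * sgn y := by
  simp only [sgn_eq_intCast]
  exact_mod_cast (by decide : ∀ x y : ZMod 2, (if x + y = 0 then 1 else -1 : ℤ) =
    (if x = 0 then 1 else -1) * (if y = 0 then 1 else -1)) x y

theorem sgn_mul_self (x : ZMod 2) : sgn x * sgn x = 1 := by
  unfold sgn; split_ifs <;> norm_num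

theorem sgn_pow_four (x : ZMod 2) : sgn x ^ 4 = 1 := by
  unfold sgn; split_ifs <;> norm_num

variable {ι : Type} [Fintype ι]

/-- The symplectic pairing on characteristics. -/
def pairing (a m : Char2 ι) : ZMod 2 := a.1 ⬝ᵥ m.2 + a.2 ⬝ᵥ m.1

theorem pairing_add_right (a m n : Char2 ι) : pairing a (m + n) = pairing a m + pairing a n := by
  simp only [pairing, Prod.fst_add, Prod.snd_add, dotProduct_add]; ring

variable [DecidableEq ι]

theorem sum_sgn_dotProduct (x : ι → ZMod 2) :
    ∑ a : ι → ZMod 2, sgn (a ⬝ᵥ x) = if x = 0 then 2 ^ Fintype.card ι else 0 := by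
  split_ifs with hx
  · simp [hx, sgn_zero]
  · obtain ⟨i, hi⟩ := Function.ne_iff.1 hx
    have hi1 : x i = 1 := (by decide : ∀ y : ZMod 2, y ≠ 0 → y = 1) _ hi
    have hneg : ∑ a : ι → ZMod 2, sgn (a ⬝ᵥ x) = -∑ a : ι → ZMod 2, sgn (a ⬝ᵥ x) := by
      rw [← Finset.sum_neg_distrib,
        ← Equiv.sum_comp (Equiv.addRight (Pi.single i (1 : ZMod 2)))]
      simp [add_dotProduct, sgn_add, hi1, sgn_one]
    exact self_eq_neg.1 hneg

theorem sum_sgn_pairing (m : Char2 ι) :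
    ∑ a : Char2 ι, sgn (pairing a m) = if m = 0 then 4 ^ Fintype.card ι else 0 := by
  simp only [pairing, sgn_add]
  rw [Fintype.sum_prod_type]
  simp only [← Finset.mul_sum, ← Finset.sum_mul, sum_sgn_dotProduct]
  rcases m with ⟨m, n⟩
  by_cases hm : m = 0 <;> by_cases hn : n = 0 <;> simp [hm, hn, ← mul_pow]
  norm_num

/-- The sum of `f` over all parallelograms. -/
def parallelogramSum (f : Char2 ι → ℂ) : ℂ :=
  ∑ c, ∑ d, ∑ m, f m * f (m + c) * (f (m + d) * f (m + d + c))

theorem char2_add_eq_zero_iff {ι : Type} {x y : Char2 ι} : x + y = 0 ↔ y = x := by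
  rw [add_eq_zero_iff_eq_neg', neg_eq_of_add_eq_zero_left (add_self_eq_zero_of_zmod_two x)]

theorem sum_sq_sum_sgn_pairing (C : Char2 ι → ℂ) :
    ∑ a, (∑ c, sgn (pairing a c) * C c) ^ 2 = 4 ^ Fintype.card ι * ∑ c, C c ^ 2 := by
  simp only [sq, Finset.sum_mul_sum]
  rw [Finset.sum_comm, Finset.mul_sum]
  refine Finset.sum_congr rfl fun c _ => ?_
  rw [Finset.sum_comm]
  have : ∀ e, ∑ a, sgn (pairing a c) * C c * (sgn (pairing a e) * C e) =
      (if e = c then 4 ^ Fintype.card ι else 0) * (C c * C e) := by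
    intro e
    rw [← if_congr (char2_add_eq_zero_iff (x := c) (y := e)) rfl rfl, ← sum_sgn_pairing,
      Finset.sum_mul]
    simp only [pairing_add_right, sgn_add]
    exact Finset.sum_congr rfl fun a _ => by ring
  simp [this]

theorem sq_sum_sgn_pairing (f : Char2 ι → ℂ) (a : Char2 ι) :
    (∑ m, sgn (pairing a m) * f m) ^ 2 =
      ∑ c, sgn (pairing a c) * ∑ m, f m * f (m + c) := by
  simp only [Finset.mul_sum]
  rw [sq, Finset.sum_mul_sum, Finset.sum_comm (s := univ (α := Char2 ι)) (γ := Char2 ι)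
    (f := fun c m => sgn (pairing a c) * (f m * f (m + c)))]
  refine Finset.sum_congr rfl fun m _ => ?_
  rw [← Equiv.sum_comp (Equiv.addLeft m) (fun n => sgn (pairing a m) * f m *
    (sgn (pairing a n) * f n))]
  refine Finset.sum_congr rfl fun c _ => ?_
  simp only [Equiv.coe_addLeft, pairing_add_right, sgn_add]
  linear_combination (sgn (pairing a c) * (f m * f (m + c))) * sgn_mul_self (pairing a m)

theorem four_pow_mul_parallelogramSum (f : Char2 ι → ℂ) :
    4 ^ Fintype.card ι * parallelogramSum f =
      ∑ a, (∑ m, sgn (pairing a m) * f m) ^ 4 := by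
  have hpow : ∀ a : Char2 ι, (∑ m, sgn (pairing a m) * f m) ^ 4 =
      (∑ c, sgn (pairing a c) * ∑ m, f m * f (m + c)) ^ 2 := fun a => by
    rw [← sq_sum_sgn_pairing]; ring
  simp only [hpow, sum_sq_sum_sgn_pairing, parallelogramSum]
  congr 1
  refine Finset.sum_congr rfl fun c _ => ?_
  rw [sq, Finset.sum_mul_sum, Finset.sum_comm]
  refine Finset.sum_congr rfl fun m _ => ?_
  rw [← Equiv.sum_comp (Equiv.addLeft m)
    (fun n => f m * f (m + c) * (f n * f (n + c)))]
  rfl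

/-- A partial Fourier transform of a symmetric function has a self-dual parallelogram sum. -/
theorem parallelogramSum_of_symmetric (G : (ι → ZMod 2) → (ι → ZMod 2) → ℂ)
    (hG : ∀ x y, G x y = G y x) (γ : ι → ZMod 2) (f : Char2 ι → ℂ)
    (hf : ∀ m, f m = ∑ κ, sgn (κ ⬝ᵥ (m.2 + γ)) * G m.1 κ) :
    parallelogramSum f = 4 ^ Fintype.card ι * ∑ m, f m ^ 4 := by
  have htrans : ∀ a : Char2 ι, ∑ m, sgn (pairing a m) * f m =
      2 ^ Fintype.card ι * sgn (a.1 ⬝ᵥ γ) * f (a.1, a.2 + γ) := by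
    intro a
    have hinner : ∀ ε : ι → ZMod 2, ∑ δ : ι → ZMod 2, sgn (pairing a (ε, δ)) * f (ε, δ) =
        2 ^ Fintype.card ι * sgn (a.1 ⬝ᵥ γ) * (sgn (a.2 ⬝ᵥ ε) * G ε a.1) := by
      intro ε
      have hκ : ∀ κ : ι → ZMod 2, ∑ δ : ι → ZMod 2,
          sgn (pairing a (ε, δ)) * (sgn (κ ⬝ᵥ (δ + γ)) * G ε κ) =
          (if κ = a.1 then 2 ^ Fintype.card ι else 0) *
            (sgn (κ ⬝ᵥ γ) * (sgn (a.2 ⬝ᵥ ε) * G ε κ)) := by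
        intro κ
        have hiff : κ = a.1 ↔ a.1 + κ = 0 := by
          rw [add_eq_zero_iff_eq_neg',
            neg_eq_of_add_eq_zero_left (add_self_eq_zero_of_zmod_two a.1)]
        simp only [hiff, ← sum_sgn_dotProduct, Finset.sum_mul]
        refine Finset.sum_congr rfl fun δ _ => ?_
        simp only [pairing, dotProduct_add, sgn_add, add_dotProduct, dotProduct_comm δ]
        ring
      simp only [hf, Finset.mul_sum]
      rw [Finset.sum_comm]
      simp only [hκ, ite_mul, zero_mul, Finset.sum_ite_eq', Finset.mem_univ, if_true]
      ring
    rw [Fintype.sum_prod_type]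
    simp only [hinner, ← Finset.mul_sum]
    rw [hf]
    congr 1
    refine Finset.sum_congr rfl fun ε _ => ?_
    rw [hG, add_assoc, add_self_eq_zero_of_zmod_two, add_zero, dotProduct_comm]
  have hfour := four_pow_mul_parallelogramSum f
  have hsum : ∑ a : Char2 ι, f (a.1, a.2 + γ) ^ 4 = ∑ a, f a ^ 4 := by
    rw [← Equiv.sum_comp (Equiv.addRight ((0, γ) : Char2 ι)) (fun a => f a ^ 4)]
    refine Finset.sum_congr rfl fun a _ => ?_
    simp [Prod.add_def]
  simp only [htrans, mul_pow, sgn_pow_four, mul_one, ← Finset.mul_sum, hsum] at hfour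
  have h4 : (4 : ℂ) ^ Fintype.card ι ≠ 0 := pow_ne_zero _ (by norm_num)
  apply mul_left_cancel₀ h4
  rw [hfour, ← mul_assoc, ← mul_pow, ← pow_mul, mul_comm _ 4, pow_mul]
  norm_num

end Fourier

open Complex

section Summability

theorem summable_prod_pi_fin : ∀ {n : ℕ} (f : Fin n → ℤ → ℝ), (∀ i k, 0 ≤ f i k) →
    (∀ i, Summable (f i)) → Summable fun v : Fin n → ℤ => ∏ i, f i (v i)
  | 0, _, _, _ => Summable.of_finite
  | n + 1, f, hf, hs => by
    rw [← (Fin.consEquiv fun _ : Fin (n + 1) => ℤ).summable_iff]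
    have := (hs 0).mul_of_nonneg
      (summable_prod_pi_fin (fun i => f i.succ) (fun i => hf i.succ) fun i => hs i.succ)
      (hf 0) (fun v => Finset.prod_nonneg fun i _ => hf i.succ _)
    refine this.congr fun p => ?_
    simp [Fin.consEquiv, Fin.prod_univ_succ]

theorem summable_exp_neg_mul_add_sq {c : ℝ} (hc : 0 < c) (x : ℝ) :
    Summable fun n : ℤ => Real.exp (-c * (n + x) ^ 2) := by
  have h := summable_pow_mul_jacobiTheta₂_term_bound (c * |x| / Real.pi)
    (T := c / Real.pi) (by positivity) 0
  refine Summable.of_nonneg_of_le (fun n => (Real.exp_pos _).le) (fun n => ?_) h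
  simp only [pow_zero, one_mul]
  refine Real.exp_le_exp.2 ?_
  have hpi := Real.pi_ne_zero
  have : -Real.pi * (c / Real.pi * n ^ 2 - 2 * (c * |x| / Real.pi) * |(n : ℝ)|) =
      -c * (n ^ 2 - 2 * (|x| * |(n : ℝ)|)) := by
    field_simp
  push_cast at this ⊢
  rw [this]
  have hx : -(|x| * |(n : ℝ)|) ≤ n * x := by
    rw [← abs_mul, mul_comm x]; exact neg_abs_le _
  nlinarith [mul_le_mul_of_nonneg_left hx hc.le, mul_nonneg hc.le (sq_nonneg x)]

variable {g : ℕ}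

theorem exists_quadratic_lower_bound {τ : Matrix (Fin g) (Fin g) ℂ} (hτ : τ ∈ Siegel (Fin g)) :
    ∃ c > 0, ∀ v : Fin g → ℝ, c * ∑ i, v i ^ 2 ≤ ∑ i, ∑ j, v i * (τ i j).im * v j := by
  have hcont : Continuous fun v : Fin g → ℝ => ∑ i, ∑ j, v i * (τ i j).im * v j := by fun_prop
  obtain ⟨c, hc, hmin⟩ := (isCompact_sphere (0 : Fin g → ℝ) 1).exists_forall_le'
    hcont.continuousOn (a := 0) fun v hv => hτ.2 v (by rintro rfl; simp at hv)
  refine ⟨c / (g + 1), by positivity, fun v => ?_⟩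
  by_cases hv : v = 0
  · simp [hv]
  have hnorm : 0 < ‖v‖ := norm_pos_iff.2 hv
  have hunit := hmin (‖v‖⁻¹ • v) (by simp [norm_smul, hnorm.ne'])
  have hscale : ∑ i, ∑ j, (‖v‖⁻¹ • v) i * (τ i j).im * (‖v‖⁻¹ • v) j =
      (‖v‖ ^ 2)⁻¹ * ∑ i, ∑ j, v i * (τ i j).im * v j := by
    simp only [Finset.mul_sum, Pi.smul_apply, smul_eq_mul]
    refine Finset.sum_congr rfl fun i _ => Finset.sum_congr rfl fun j _ => ?_
    field_simp
  rw [hscale, inv_mul_eq_div, le_div_iff₀ (by positivity)] at hunit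
  have hsum : ∑ i, v i ^ 2 ≤ g * ‖v‖ ^ 2 := by
    calc ∑ i, v i ^ 2 ≤ ∑ _i : Fin g, ‖v‖ ^ 2 := Finset.sum_le_sum fun i _ => by
          rw [← sq_abs]
          exact pow_le_pow_left₀ (abs_nonneg _) (norm_le_pi_norm v i) 2
      _ = g * ‖v‖ ^ 2 := by simp
  refine le_trans ?_ hunit
  rw [div_mul_eq_mul_div, div_le_iff₀ (by positivity)]
  nlinarith [mul_le_mul_of_nonneg_left hsum hc.le, mul_pos hc (pow_pos hnorm 2)]

/-- The general term `exp (πi (a uᵀτu + uᵀd))` of a theta series. -/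
def thetaTerm (τ : Matrix (Fin g) (Fin g) ℂ) (a : ℝ) (d : Fin g → ℤ) (u : Fin g → ℝ) : ℂ :=
  exp (Real.pi * I * (a * (∑ i, ∑ j, (u i : ℂ) * τ i j * u j) + ∑ i, (u i : ℂ) * d i))

/-- The theta series over the translated lattice `ℤ ^ g + x`. -/
def thetaSum (τ : Matrix (Fin g) (Fin g) ℂ) (a : ℝ) (d : Fin g → ℤ) (x : Fin g → ℝ) : ℂ :=
  ∑' n : Fin g → ℤ, thetaTerm τ a d (fun i => n i + x i)

theorem norm_thetaTerm (τ : Matrix (Fin g) (Fin g) ℂ) (a : ℝ) (d : Fin g → ℤ) (u : Fin g → ℝ) :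
    ‖thetaTerm τ a d u‖ =
      Real.exp (-(Real.pi * a) * ∑ i, ∑ j, u i * (τ i j).im * u j) := by
  rw [thetaTerm, norm_exp]
  congr 1
  have hlin : (∑ i, (u i : ℂ) * d i) = ((∑ i, u i * d i : ℝ) : ℂ) := by push_cast; rfl
  have hquad : (∑ i, ∑ j, (u i : ℂ) * τ i j * u j).im = ∑ i, ∑ j, u i * (τ i j).im * u j := by
    simp [Complex.im_sum, Complex.mul_im]
  rw [hlin, mul_comm (Real.pi : ℂ) I, mul_assoc, Complex.I_mul_re,
    Complex.im_ofReal_mul, Complex.add_im, Complex.ofReal_im, Complex.im_ofReal_mul, hquad]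
  ring

theorem summable_norm_thetaTerm {τ : Matrix (Fin g) (Fin g) ℂ} (hτ : τ ∈ Siegel (Fin g))
    {a : ℝ} (ha : 0 < a) (d : Fin g → ℤ) (x : Fin g → ℝ) :
    Summable fun n : Fin g → ℤ => ‖thetaTerm τ a d (fun i => n i + x i)‖ := by
  obtain ⟨c, hc, hbound⟩ := exists_quadratic_lower_bound hτ
  have hpi := Real.pi_pos
  have hprod := summable_prod_pi_fin
    (fun (i : Fin g) (n : ℤ) => Real.exp (-(Real.pi * a * c) * (n + x i) ^ 2))
    (fun _ _ => (Real.exp_pos _).le)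
    (fun i => summable_exp_neg_mul_add_sq (by positivity) (x i))
  refine Summable.of_nonneg_of_le (fun _ => norm_nonneg _) (fun n => ?_) hprod
  rw [norm_thetaTerm, ← Real.exp_sum, ← Finset.mul_sum]
  refine Real.exp_le_exp.2 ?_
  have := mul_le_mul_of_nonneg_left (hbound fun i => n i + x i) (by positivity : 0 ≤ Real.pi * a)
  linarith

end Summability

section ThetaSums

variable {g : ℕ}

theorem thetaSum_add_intCast (τ : Matrix (Fin g) (Fin g) ℂ) (a : ℝ) (d k : Fin g → ℤ)
    (x : Fin g → ℝ) : thetaSum τ a d (fun i => x i + k i) = thetaSum τ a d x := by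
  unfold thetaSum
  rw [← (Equiv.addRight k).tsum_eq (fun n => thetaTerm τ a d fun i => n i + x i)]
  refine tsum_congr fun n => congrArg _ (funext fun i => ?_)
  simp only [Equiv.coe_addRight, Pi.add_apply]
  push_cast
  ring

theorem exp_pi_mul_I_mul_intCast (k : ℤ) : exp (Real.pi * I * k) = (-1) ^ k := by
  rw [mul_comm, exp_int_mul, exp_pi_mul_I]

theorem thetaSum_add_two_mul (τ : Matrix (Fin g) (Fin g) ℂ) (d k e : Fin g → ℤ) :
    thetaSum τ 1 (fun i => d i + 2 * k i) (fun i => e i / 2) =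
      (-1) ^ (∑ i, e i * k i) * thetaSum τ 1 d (fun i => e i / 2) := by
  unfold thetaSum
  rw [← tsum_mul_left]
  refine tsum_congr fun n => ?_
  have heven : ((-1 : ℂ)) ^ (∑ i, e i * k i) = (-1) ^ (∑ i, (2 * n i + e i) * k i) := by
    have : ∑ i, (2 * n i + e i) * k i = 2 * (∑ i, n i * k i) + ∑ i, e i * k i := by
      rw [Finset.mul_sum, ← Finset.sum_add_distrib]
      exact Finset.sum_congr rfl fun i _ => by ring
    rw [this, zpow_add₀ (by norm_num), zpow_mul]
    norm_num
  rw [heven, ← exp_pi_mul_I_mul_intCast, thetaTerm, thetaTerm, ← exp_add]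
  congr 1
  push_cast
  have : ∑ i, ((n i : ℂ) + e i / 2) * (d i + 2 * k i) =
      ∑ i, ((n i : ℂ) + e i / 2) * d i + ∑ i, (2 * (n i : ℂ) + e i) * k i := by
    rw [← Finset.sum_add_distrib]
    exact Finset.sum_congr rfl fun i _ => by ring
  rw [this]
  ring

theorem thetaConst_eq_thetaSum (τ : Matrix (Fin g) (Fin g) ℂ) (m : Char2 (Fin g)) :
    thetaConst m τ =
      thetaSum τ 1 (fun i => ((m.2 i).val : ℤ)) (fun i => ((m.1 i).val : ℤ) / 2) := by
  unfold thetaConst thetaChar theta thetaSum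
  refine tsum_congr fun n => ?_
  unfold thetaTerm
  congr 2
  push_cast
  rw [one_mul, Finset.mul_sum]
  congr 1
  refine Finset.sum_congr rfl fun i _ => ?_
  simp only [Pi.zero_apply]
  ring

theorem thetaSum_eq_zero_of_odd (τ : Matrix (Fin g) (Fin g) ℂ) (d e : Fin g → ℤ)
    (hodd : Odd (∑ i, e i * d i)) : thetaSum τ 1 d (fun i => e i / 2) = 0 := by
  have hneg : thetaSum τ 1 (fun i => d i + 2 * (-d i)) (fun i => e i / 2) =
      thetaSum τ 1 d (fun i => e i / 2) := by
    unfold thetaSum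
    rw [← (Equiv.subLeft (-e)).tsum_eq (fun n => thetaTerm τ 1 d fun i => n i + e i / 2)]
    refine tsum_congr fun n => ?_
    unfold thetaTerm
    congr 2
    congr 1
    · congr 1
      refine Finset.sum_congr rfl fun i _ => Finset.sum_congr rfl fun j _ => ?_
      simp only [Equiv.subLeft_apply, Pi.sub_apply, Pi.neg_apply]
      push_cast
      ring
    · refine Finset.sum_congr rfl fun i _ => ?_
      simp only [Equiv.subLeft_apply, Pi.sub_apply, Pi.neg_apply]
      push_cast
      ring
  have hsign : ((-1 : ℂ)) ^ (∑ i, e i * -d i) = -1 := by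
    refine Odd.neg_one_zpow ?_
    simpa using hodd
  rw [thetaSum_add_two_mul, hsign] at hneg
  linear_combination (-1 / 2 : ℂ) * hneg

theorem thetaConst_eq_zero_of_odd (τ : Matrix (Fin g) (Fin g) ℂ) {m : Char2 (Fin g)}
    (hm : m.1 ⬝ᵥ m.2 ≠ 0) : thetaConst m τ = 0 := by
  rw [thetaConst_eq_thetaSum]
  apply thetaSum_eq_zero_of_odd
  rw [← Int.not_even_iff_odd, ← ZMod.intCast_eq_zero_iff_even]
  push_cast
  simpa [dotProduct] using hm

end ThetaSums

section ProductFormula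

variable {g : ℕ}

/-- The lift of a vector over `𝔽₂` to an integral vector with entries `0` and `1`. -/
def lift (x : Fin g → ZMod 2) (i : Fin g) : ℤ := (x i).val

theorem thetaTerm_sub_mul_thetaTerm_add (τ : Matrix (Fin g) (Fin g) ℂ) (d c : Fin g → ℤ)
    (u v : Fin g → ℝ) :
    thetaTerm τ 1 d (u - v) * thetaTerm τ 1 (d + c) (u + v) =
      exp (Real.pi * I * ∑ i, 2 * (u i : ℂ) * d i) * (thetaTerm τ 2 c u * thetaTerm τ 2 c v) := by
  unfold thetaTerm
  rw [← exp_add, ← exp_add, ← exp_add]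
  congr 1
  have hquad : ∑ i, ∑ j, ((u - v) i : ℂ) * τ i j * ((u - v) j : ℝ) +
      ∑ i, ∑ j, ((u + v) i : ℂ) * τ i j * ((u + v) j : ℝ) =
      2 * ∑ i, ∑ j, (u i : ℂ) * τ i j * u j + 2 * ∑ i, ∑ j, (v i : ℂ) * τ i j * v j := by
    simp only [Finset.mul_sum, ← Finset.sum_add_distrib, Pi.sub_apply, Pi.add_apply]
    refine Finset.sum_congr rfl fun i _ => Finset.sum_congr rfl fun j _ => ?_
    push_cast
    ring
  have hlin : ∑ i, ((u - v) i : ℂ) * d i + ∑ i, ((u + v) i : ℂ) * ((d + c) i : ℤ) =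
      ∑ i, 2 * (u i : ℂ) * d i + (∑ i, (u i : ℂ) * c i + ∑ i, (v i : ℂ) * c i) := by
    simp only [← Finset.sum_add_distrib, Pi.sub_apply, Pi.add_apply]
    refine Finset.sum_congr rfl fun i _ => ?_
    push_cast
    ring
  push_cast at hquad hlin ⊢
  linear_combination Real.pi * I * hquad + Real.pi * I * hlin

/-- Pairs of integral vectors in terms of halves of their sum and difference. -/
def halfSumEquiv (e : Fin g → ℤ) :
    (Fin g → ZMod 2) × ((Fin g → ℤ) × (Fin g → ℤ)) ≃ (Fin g → ℤ) × (Fin g → ℤ) where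
  toFun p := (fun i => p.2.1 i - p.2.2 i - e i, fun i => p.2.1 i + p.2.2 i + lift p.1 i)
  invFun q := (fun i => ((q.1 i + q.2 i + e i : ℤ) : ZMod 2),
    fun i => (q.1 i + q.2 i + e i) / 2,
    fun i => q.2 i - (q.1 i + q.2 i + e i) / 2 - (q.1 i + q.2 i + e i) % 2)
  left_inv := by
    rintro ⟨σ, k, l⟩
    have hsum : ∀ i, k i - l i - e i + (k i + l i + lift σ i) + e i = 2 * k i + lift σ i :=
      fun i => by ring
    have hlift : ∀ i, 0 ≤ lift σ i ∧ lift σ i < 2 := fun i =>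
      ⟨Int.natCast_nonneg _, Int.ofNat_lt.2 (σ i).val_lt⟩
    simp only [hsum, Prod.mk.injEq]
    refine ⟨funext fun i => ?_, funext fun i => ?_, funext fun i => ?_⟩
    · push_cast [lift]
      rw [show (2 : ZMod 2) = 0 from rfl]
      simp
    · have := hlift i
      omega
    · have := hlift i
      omega
  right_inv := by
    rintro ⟨n, m⟩
    have hlift : ∀ i, lift (fun i => ((n i + m i + e i : ℤ) : ZMod 2)) i =
        (n i + m i + e i) % 2 := fun i => ZMod.val_intCast (n i + m i + e i)
    simp only [hlift, Prod.mk.injEq]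
    exact ⟨funext fun i => by omega, funext fun i => by omega⟩

theorem exp_pi_mul_I_mul_sum_lift (k : Fin g → ℤ) (σ β δ : Fin g → ZMod 2) :
    exp (Real.pi * I * ∑ i, 2 * ((k i + (lift β i / 4 + lift σ i / 2) : ℝ) : ℂ) * lift δ i) =
      I ^ (∑ i, (β i).val * (δ i).val) * sgn (σ ⬝ᵥ δ) := by
  have hsplit : Real.pi * I * ∑ i, 2 * ((k i + (lift β i / 4 + lift σ i / 2) : ℝ) : ℂ) * lift δ i =
      (∑ i, (β i).val * (δ i).val : ℕ) * (Real.pi / 2 * I) +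
        (Real.pi * I * (∑ i, (2 * k i + lift σ i) * lift δ i : ℤ)) := by
    push_cast [lift]
    simp only [Finset.mul_sum, Finset.sum_mul, ← Finset.sum_add_distrib]
    refine Finset.sum_congr rfl fun i _ => ?_
    ring
  have hsgn : ∀ n : ℤ, ((-1 : ℂ)) ^ n = sgn n := by
    intro n
    unfold sgn
    split_ifs with h
    · exact (ZMod.intCast_eq_zero_iff_even.1 h).neg_one_zpow
    · exact (Int.not_even_iff_odd.1 (mt ZMod.intCast_eq_zero_iff_even.2 h)).neg_one_zpow
  rw [hsplit, exp_add, exp_nat_mul, exp_pi_div_two_mul_I, exp_pi_mul_I_mul_intCast, hsgn]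
  congr 2
  push_cast [lift, dotProduct]
  refine Finset.sum_congr rfl fun i _ => ?_
  rw [show (2 : ZMod 2) = 0 from rfl]
  simp

/-- The theta series of level two that enter the product of two theta constants. -/
def halfTheta (τ : Matrix (Fin g) (Fin g) ℂ) (b : Char2 (Fin g)) (σ : Fin g → ZMod 2) : ℂ :=
  thetaSum τ 2 (lift b.2) (fun i => lift b.1 i / 4 + lift σ i / 2)

theorem lift_add (x y : Fin g → ZMod 2) (i : Fin g) :
    lift (x + y) i = lift x i + lift y i - 2 * (lift x i * lift y i) :=
  (by decide : ∀ a b : ZMod 2, ((a + b).val : ℤ) = a.val + b.val - 2 * (a.val * b.val)) (x i) (y i)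

theorem halfTheta_add (τ : Matrix (Fin g) (Fin g) ℂ) (b : Char2 (Fin g))
    (σ ε : Fin g → ZMod 2) : halfTheta τ b (σ + ε) =
      thetaSum τ 2 (lift b.2) (fun i => lift b.1 i / 4 + (lift σ i + lift ε i) / 2) := by
  rw [halfTheta, ← thetaSum_add_intCast τ 2 (lift b.2) (fun i => lift σ i * lift ε i)]
  refine congrArg _ (funext fun i => ?_)
  rw [lift_add]
  push_cast
  ring

theorem thetaSum_mul_thetaSum {τ : Matrix (Fin g) (Fin g) ℂ} (hτ : τ ∈ Siegel (Fin g))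
    (ε δ : Fin g → ZMod 2) (b : Char2 (Fin g)) :
    thetaSum τ 1 (lift δ) (fun i => lift ε i / 2) *
        thetaSum τ 1 (lift δ + lift b.2) (fun i => (lift ε i + lift b.1 i) / 2) =
      I ^ (∑ i, (b.1 i).val * (δ i).val) *
        ∑ σ, sgn (σ ⬝ᵥ δ) * (halfTheta τ b σ * halfTheta τ b (σ + ε)) := by
  have hs1 := summable_norm_thetaTerm hτ one_pos (lift δ) (fun i => lift ε i / 2)
  have hs2 := summable_norm_thetaTerm hτ one_pos (lift δ + lift b.2)
    (fun i => (lift ε i + lift b.1 i) / 2)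
  have hterm : ∀ p : (Fin g → ZMod 2) × ((Fin g → ℤ) × (Fin g → ℤ)),
      thetaTerm τ 1 (lift δ) (fun i => (halfSumEquiv (lift ε) p).1 i + lift ε i / 2) *
        thetaTerm τ 1 (lift δ + lift b.2)
          (fun i => (halfSumEquiv (lift ε) p).2 i + (lift ε i + lift b.1 i) / 2) =
      I ^ (∑ i, (b.1 i).val * (δ i).val) * sgn (p.1 ⬝ᵥ δ) *
        (thetaTerm τ 2 (lift b.2) (fun i => p.2.1 i + (lift b.1 i / 4 + lift p.1 i / 2)) *
          thetaTerm τ 2 (lift b.2)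
            (fun i => p.2.2 i + (lift b.1 i / 4 + (lift p.1 i + lift ε i) / 2))) := by
    rintro ⟨σ, k, l⟩
    rw [← exp_pi_mul_I_mul_sum_lift k, ← thetaTerm_sub_mul_thetaTerm_add]
    congr 1
    · refine congrArg _ (funext fun i => ?_)
      simp only [halfSumEquiv, Equiv.coe_fn_mk, Pi.sub_apply]
      push_cast
      ring
    · refine congrArg _ (funext fun i => ?_)
      simp only [halfSumEquiv, Equiv.coe_fn_mk, Pi.add_apply]
      push_cast
      ring
  have hsum : Summable fun p => thetaTerm τ 1 (lift δ)
      (fun i => (halfSumEquiv (lift ε) p).1 i + lift ε i / 2) *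
        thetaTerm τ 1 (lift δ + lift b.2)
          (fun i => (halfSumEquiv (lift ε) p).2 i + (lift ε i + lift b.1 i) / 2) :=
    (halfSumEquiv (lift ε)).summable_iff.2 (summable_mul_of_summable_norm hs1 hs2)
  rw [thetaSum, thetaSum, tsum_mul_tsum_of_summable_norm hs1 hs2,
    ← (halfSumEquiv (lift ε)).tsum_eq, hsum.tsum_prod, tsum_fintype, Finset.mul_sum]
  refine Finset.sum_congr rfl fun σ _ => ?_
  simp only [hterm, tsum_mul_left]
  rw [mul_assoc, halfTheta_add, halfTheta, thetaSum, thetaSum, tsum_mul_tsum_of_summable_norm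
    (summable_norm_thetaTerm hτ two_pos _ _) (summable_norm_thetaTerm hτ two_pos _ _)]

/-- The exponent of the power of `i` that enters the product of two theta constants. -/
def phaseExp (b m : Char2 (Fin g)) : ℕ :=
  ∑ i, ((b.1 i).val * (m.2 i).val +
    2 * (((m.1 i).val + (b.1 i).val) * ((m.2 i).val * (b.2 i).val)))

theorem thetaConst_mul_thetaConst_add {τ : Matrix (Fin g) (Fin g) ℂ} (hτ : τ ∈ Siegel (Fin g))
    (b m : Char2 (Fin g)) :
    thetaConst m τ * thetaConst (m + b) τ = I ^ phaseExp b m *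
      ∑ σ, sgn (σ ⬝ᵥ m.2) * (halfTheta τ b σ * halfTheta τ b (σ + m.1)) := by
  have hm : thetaConst m τ = thetaSum τ 1 (lift m.2) (fun i => lift m.1 i / 2) :=
    thetaConst_eq_thetaSum τ m
  have hmb : thetaConst (m + b) τ =
      (-1) ^ (∑ i, ((m.1 i).val + (b.1 i).val) * ((m.2 i).val * (b.2 i).val)) *
        thetaSum τ 1 (lift m.2 + lift b.2) (fun i => (lift m.1 i + lift b.1 i) / 2) := by
    have h1 : thetaConst (m + b) τ =
        thetaSum τ 1 (lift (m.2 + b.2)) (fun i => lift (m.1 + b.1) i / 2) :=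
      thetaConst_eq_thetaSum τ (m + b)
    have h2 := thetaSum_add_two_mul τ (lift (m.2 + b.2)) (fun i => lift m.2 i * lift b.2 i)
      (fun i => lift m.1 i + lift b.1 i)
    have h3 := thetaSum_add_intCast τ 1 (lift (m.2 + b.2)) (fun i => lift m.1 i * lift b.1 i)
      (fun i => lift (m.1 + b.1) i / 2)
    have hshift : (fun i => (lift (m.1 + b.1) i / 2 + (lift m.1 i * lift b.1 i : ℤ) : ℝ)) =
        fun i => ((lift m.1 i + lift b.1 i : ℤ) : ℝ) / 2 := by
      funext i
      rw [lift_add]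
      push_cast
      ring
    have hchar : (fun i => lift (m.2 + b.2) i + 2 * (lift m.2 i * lift b.2 i)) =
        lift m.2 + lift b.2 := by
      funext i
      rw [lift_add]
      simp
    have hexp : ∑ i, (lift m.1 i + lift b.1 i) * (lift m.2 i * lift b.2 i) =
        (∑ i, ((m.1 i).val + (b.1 i).val) * ((m.2 i).val * (b.2 i).val) : ℕ) := by
      push_cast [lift]
      rfl
    rw [hshift] at h3
    rw [hchar, hexp, zpow_natCast, h3, ← h1] at h2
    push_cast at h2
    rw [h2, ← mul_assoc, ← mul_pow]
    norm_num
  rw [hm, hmb, mul_left_comm, thetaSum_mul_thetaSum hτ, ← mul_assoc, phaseExp,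
    Finset.sum_add_distrib, pow_add, ← Finset.mul_sum, pow_mul, I_sq, mul_comm (I ^ _)]

end ProductFormula

section Relations

variable {g : ℕ}

theorem four_dvd_sum_phaseExp (b c n d m : Char2 (Fin g)) :
    4 ∣ (phaseExp b m + phaseExp b (m + c)) + (phaseExp b (m + n) + phaseExp b (m + n + c)) +
      ((phaseExp b (m + d) + phaseExp b (m + d + c)) +
        (phaseExp b (m + d + n) + phaseExp b (m + d + n + c))) := by
  have hval : ∀ x c n d : ZMod 2, 4 ∣ (x.val + (x + c).val) + ((x + n).val + (x + n + c).val) +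
      (((x + d).val + (x + d + c).val) + ((x + d + n).val + (x + d + n + c).val)) := by
    decide
  have hquad : ∀ x y c c' n n' d d' : ZMod 2, 2 ∣
      (x.val * y.val + (x + c).val * (y + c').val) +
        ((x + n).val * (y + n').val + (x + n + c).val * (y + n' + c').val) +
      (((x + d).val * (y + d').val + (x + d + c).val * (y + d' + c').val) +
        ((x + d + n).val * (y + d' + n').val +
          (x + d + n + c).val * (y + d' + n' + c').val)) := by
    decide +kernel
  simp only [phaseExp, ← Finset.sum_add_distrib]
  refine Finset.dvd_sum fun i _ => ?_
  simp only [Prod.fst_add, Prod.snd_add, Pi.add_apply]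
  obtain ⟨p, hp⟩ := hval (m.2 i) (c.2 i) (n.2 i) (d.2 i)
  obtain ⟨q, hq⟩ := hquad (m.1 i) (m.2 i) (c.1 i) (c.2 i) (n.1 i) (n.2 i) (d.1 i) (d.2 i)
  refine ⟨(b.1 i).val * p + (b.2 i).val * q + 2 * ((b.1 i).val * (b.2 i).val * p), ?_⟩
  linear_combination (b.1 i).val * hp + 2 * (b.2 i).val * hq + 2 * (b.1 i).val * (b.2 i).val * hp

theorem parallelogramSum_cubeProd {τ : Matrix (Fin g) (Fin g) ℂ} (hτ : τ ∈ Siegel (Fin g))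
    (b c : Char2 (Fin g)) :
    parallelogramSum (cubeProd (fun m => thetaConst m τ) [c, b]) =
      4 ^ g * ∑ m, cubeProd (fun m => thetaConst m τ) [c, b] m ^ 4 := by
  set a := halfTheta τ b
  set φ : Char2 (Fin g) → ℂ := fun m => (∑ σ, sgn (σ ⬝ᵥ m.2) * (a σ * a (σ + m.1))) *
    ∑ ρ, sgn (ρ ⬝ᵥ (m + c).2) * (a ρ * a (ρ + (m + c).1)) with hφ
  set N : Char2 (Fin g) → ℕ := fun m => phaseExp b m + phaseExp b (m + c) with hN
  have hprod : ∀ m, cubeProd (fun m => thetaConst m τ) [c, b] m = I ^ N m * φ m := by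
    intro m
    simp only [cubeProd, thetaConst_mul_thetaConst_add hτ, hφ, hN, pow_add]
    ring
  have hphase : ∀ n d m, I ^ N m * I ^ N (m + n) * (I ^ N (m + d) * I ^ N (m + d + n)) = 1 := by
    intro n d m
    obtain ⟨k, hk⟩ := four_dvd_sum_phaseExp b c n d m
    simp only [← pow_add, hN]
    rw [hk, pow_mul, I_pow_four, one_pow]
  have hconv : ∀ m, φ m = ∑ κ, sgn (κ ⬝ᵥ (m.2 + c.2)) *
      ∑ σ, sgn (σ ⬝ᵥ c.2) * (a σ * a (σ + m.1) * a (σ + κ) * a (σ + κ + (m.1 + c.1))) := by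
    intro m
    simp only [Finset.mul_sum]
    rw [show φ m = _ * _ from rfl, Finset.sum_mul_sum, Finset.sum_comm (γ := Fin g → ZMod 2)
      (f := fun κ σ => sgn (κ ⬝ᵥ (m.2 + c.2)) * (sgn (σ ⬝ᵥ c.2) *
        (a σ * a (σ + m.1) * a (σ + κ) * a (σ + κ + (m.1 + c.1)))))]
    refine Finset.sum_congr rfl fun σ _ => ?_
    rw [← Equiv.sum_comp (Equiv.addLeft σ)]
    refine Finset.sum_congr rfl fun κ _ => ?_
    simp only [Equiv.coe_addLeft, add_dotProduct, dotProduct_add, sgn_add, Prod.fst_add,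
      Prod.snd_add]
    linear_combination (sgn (κ ⬝ᵥ m.2) * sgn (κ ⬝ᵥ c.2) * sgn (σ ⬝ᵥ c.2) *
      (a σ * a (σ + m.1) * a (σ + κ) * a (σ + κ + (m.1 + c.1)))) * sgn_mul_self (σ ⬝ᵥ m.2)
  have hsymm := parallelogramSum_of_symmetric
    (fun ε κ => ∑ σ, sgn (σ ⬝ᵥ c.2) * (a σ * a (σ + ε) * a (σ + κ) * a (σ + κ + (ε + c.1))))
    (fun ε κ => Finset.sum_congr rfl fun σ _ => by
      rw [show σ + κ + (ε + c.1) = σ + ε + (κ + c.1) by abel]; ring) c.2 φ hconv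
  rw [Fintype.card_fin] at hsymm
  have hpar : parallelogramSum (cubeProd (fun m => thetaConst m τ) [c, b]) =
      parallelogramSum φ := by
    unfold parallelogramSum
    refine Finset.sum_congr rfl fun n _ => Finset.sum_congr rfl fun d _ =>
      Finset.sum_congr rfl fun m _ => ?_
    rw [hprod, hprod, hprod, hprod]
    linear_combination (φ m * φ (m + n) * (φ (m + d) * φ (m + d + n))) * hphase n d m
  rw [hpar, hsymm]
  congr 1
  refine Finset.sum_congr rfl fun m _ => ?_
  rw [hprod, mul_pow (I ^ N m), ← pow_mul, mul_comm (N m), pow_mul, I_pow_four, one_pow, one_mul]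

variable {τ : Matrix (Fin g) (Fin g) ℂ}

theorem tupleSum_cosetSum_four (hτ : τ ∈ Siegel (Fin g)) :
    tupleSum (cosetSum fun m : Char2 (Fin g) => thetaConst m τ) 4 ⊥ =
      4 ^ g * tupleSum (cosetSum fun m : Char2 (Fin g) => thetaConst m τ) 2 ⊥ := by
  set h := fun m : Char2 (Fin g) => thetaConst m τ with hh
  change ∑ b, ∑ c, ∑ n, ∑ d, cosetSum h (listSpan [d, n, c, b]) =
    4 ^ g * ∑ b, ∑ c, cosetSum h (listSpan [c, b])
  simp only [Finset.mul_sum (s := univ (α := Char2 (Fin g)))]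
  refine Finset.sum_congr rfl fun b _ => Finset.sum_congr rfl fun c _ => ?_
  have := parallelogramSum_cubeProd hτ b c
  rw [cosetSum_listSpan _ _ (by simp)]
  refine Eq.trans ?_ this
  refine Finset.sum_congr rfl fun n _ => Finset.sum_congr rfl fun d _ => ?_
  rw [cosetSum_listSpan _ _ (by simp)]
  simp [cubeProd, hh]

theorem tupleSum_cosetSum_three (hτ : τ ∈ Siegel (Fin g)) :
    tupleSum (cosetSum fun m : Char2 (Fin g) => thetaConst m τ) 3 ⊥ =
      4 ^ g * tupleSum (cosetSum fun m : Char2 (Fin g) => thetaConst m τ) 1 ⊥ := by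
  set h := fun m : Char2 (Fin g) => thetaConst m τ with hh
  change ∑ b, ∑ n, ∑ d, cosetSum h (listSpan [d, n, b]) = 4 ^ g * ∑ b, cosetSum h (listSpan [b])
  simp only [Finset.mul_sum (s := univ (α := Char2 (Fin g)))]
  refine Finset.sum_congr rfl fun b _ => ?_
  have := parallelogramSum_cubeProd hτ b 0
  rw [cosetSum_listSpan _ _ (by simp)]
  refine Eq.trans ?_ (this.trans ?_)
  · refine Finset.sum_congr rfl fun n _ => Finset.sum_congr rfl fun d _ => ?_
    rw [cosetSum_listSpan _ _ (by simp)]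
    refine Finset.sum_congr rfl fun m _ => ?_
    simp [cubeProd, hh]
    ring
  · congr 1
    refine Finset.sum_congr rfl fun m _ => ?_
    simp [cubeProd, hh]
    ring

theorem tupleSum_cosetSum_two (hτ : τ ∈ Siegel (Fin g)) :
    tupleSum (cosetSum fun m : Char2 (Fin g) => thetaConst m τ) 2 ⊥ =
      4 ^ g * tupleSum (cosetSum fun m : Char2 (Fin g) => thetaConst m τ) 0 ⊥ := by
  set h := fun m : Char2 (Fin g) => thetaConst m τ with hh
  change ∑ n, ∑ d, cosetSum h (listSpan [d, n]) = 4 ^ g * cosetSum h (listSpan [])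
  have := parallelogramSum_cubeProd hτ 0 0
  rw [cosetSum_listSpan _ _ (by simp)]
  refine Eq.trans ?_ (this.trans ?_)
  · refine Finset.sum_congr rfl fun n _ => Finset.sum_congr rfl fun d _ => ?_
    rw [cosetSum_listSpan _ _ (by simp)]
    refine Finset.sum_congr rfl fun m _ => ?_
    simp [cubeProd, hh]
    ring
  · congr 1
    refine Finset.sum_congr rfl fun m _ => ?_
    simp [cubeProd, hh]
    ring

end Relations

section Vanishing

variable {g : ℕ}

/-- The symplectic pairing on characteristics as a bilinear form. -/
def pairingForm (ι : Type) [Fintype ι] : LinearMap.BilinForm (ZMod 2) (Char2 ι) :=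
  LinearMap.mk₂ (ZMod 2) pairing
    (fun a b m => by simp only [pairing, Prod.fst_add, Prod.snd_add, add_dotProduct]; ring)
    (fun t a m => by simp [pairing, mul_add])
    pairing_add_right
    (fun t a m => by simp [pairing, mul_add])

theorem pairing_comm {ι : Type} [Fintype ι] (a m : Char2 ι) : pairing a m = pairing m a := by
  rw [pairing, pairing, dotProduct_comm a.1, dotProduct_comm a.2, add_comm]

theorem eq_zero_of_forall_pairing_eq_zero {ι : Type} [Fintype ι] {a : Char2 ι}
    (ha : ∀ m, pairing a m = 0) : a = 0 := by
  classical
  refine Prod.ext (funext fun i => ?_) (funext fun i => ?_)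
  · simpa [pairing] using ha (0, Pi.single i 1)
  · simpa [pairing] using ha (Pi.single i 1, 0)

theorem nondegenerate_pairingForm (ι : Type) [Fintype ι] : (pairingForm ι).Nondegenerate :=
  ⟨fun _ ha => eq_zero_of_forall_pairing_eq_zero ha,
    fun _ ha => eq_zero_of_forall_pairing_eq_zero fun m => (pairing_comm _ _).trans (ha m)⟩

theorem finrank_le_of_isotropic {ι : Type} [Fintype ι] {V : Submodule (ZMod 2) (Char2 ι)}
    (hV : ∀ v ∈ V, ∀ w ∈ V, pairing v w = 0) : finrank (ZMod 2) V ≤ Fintype.card ι := by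
  have hle : V ≤ (pairingForm ι).orthogonal V := fun w hw v hv => hV v hv w hw
  have h1 := Submodule.finrank_mono hle
  have h2 := LinearMap.BilinForm.finrank_orthogonal (nondegenerate_pairingForm ι) V
  have h3 : finrank (ZMod 2) (Char2 ι) = Fintype.card ι + Fintype.card ι := by
    simp [Module.finrank_prod]
  omega

theorem cosetProd_thetaConst_eq_zero (τ : Matrix (Fin g) (Fin g) ℂ)
    {V : Submodule (ZMod 2) (Char2 (Fin g))} (hV : g < finrank (ZMod 2) V) (m : Char2 (Fin g)) :
    cosetProd (fun m => thetaConst m τ) V m = 0 := by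
  classical
  by_contra hne
  have heven : ∀ v ∈ V, (m + v).1 ⬝ᵥ (m + v).2 = 0 := by
    intro v hv
    by_contra hodd
    exact hne (Finset.prod_eq_zero (Finset.mem_filter.2 ⟨Finset.mem_univ v, hv⟩)
      (thetaConst_eq_zero_of_odd τ hodd))
  refine hV.not_ge ((finrank_le_of_isotropic fun v hv w hw => ?_).trans_eq (Fintype.card_fin g))
  have h0 := heven 0 V.zero_mem
  have hv' := heven v hv
  have hw' := heven w hw
  have hvw := heven (v + w) (V.add_mem hv hw)
  simp only [Prod.fst_add, Prod.snd_add, Prod.fst_zero, Prod.snd_zero, add_dotProduct,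
    dotProduct_add, zero_dotProduct, dotProduct_zero] at h0 hv' hw' hvw
  rw [pairing, dotProduct_comm v.2]
  linear_combination hvw - hv' - hw' + h0

theorem indepSum_thetaConst_eq_zero (τ : Matrix (Fin g) (Fin g) ℂ) {j : ℕ} (hj : g < j) :
    indepSum (cosetSum fun m : Char2 (Fin g) => thetaConst m τ) j 0 = 0 := by
  classical
  refine Finset.sum_eq_zero fun b hb => ?_
  have hb : LinearIndependent (ZMod 2) b := (Finset.mem_filter.1 hb).2
  refine Finset.sum_eq_zero fun m _ => ?_
  rw [cosetProd_thetaConst_eq_zero τ (by rwa [finrank_span_eq_card hb, Fintype.card_fin]),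
    zero_pow (by positivity)]

end Vanishing

end Cosmological

/-- For `g ≤ 3` the cosmological constant `Ξ^{(g)}` vanishes identically on `ℍ_g`. -/
theorem XiCosm_vanishes_low_genus (g : ℕ) (hg : g ∈ ({1, 2, 3} : Set ℕ))
    (τ : Matrix (Fin g) (Fin g) ℂ) (hτ : τ ∈ Siegel (Fin g)) :
    XiCosm (Fin g) τ = 0 := by
  set F := Cosmological.cosetSum fun m : Char2 (Fin g) => thetaConst m τ with hF
  have h2 := Cosmological.tupleSum_cosetSum_two hτ
  have h3 := Cosmological.tupleSum_cosetSum_three hτ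
  have h4 := Cosmological.tupleSum_cosetSum_four hτ
  have hvan := Cosmological.indepSum_thetaConst_eq_zero τ (Nat.lt_succ_self g)
  have hS0 := Cosmological.indepSum_cosetSum_zero_right 0 τ
  have hS1 := Cosmological.indepSum_cosetSum_zero_right 1 τ
  have hS2 := Cosmological.indepSum_cosetSum_zero_right 2 τ
  have hS3 := Cosmological.indepSum_cosetSum_zero_right 3 τ
  simp only [← Cosmological.indepSum_zero_left, Cosmological.indepSum_succ] at h2 h3 h4
  simp only [← hF, Fin.prod_univ_succ, Fin.prod_univ_zero] at h2 h3 h4 hvan hS0 hS1 hS2 hS3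
  norm_num at h2 h3 h4 hvan hS0 hS1 hS2 hS3
  rcases hg with rfl | rfl | rfl
  · norm_num [hvan, hS0, hS1] at h2
    simp only [XiCosm, Fintype.card_fin, Finset.sum_range_succ, Finset.sum_range_zero]
    norm_num
    linear_combination (-1 / 3) * h2
  · norm_num [hvan, hS0, hS1, hS2] at h2 h3
    simp only [XiCosm, Fintype.card_fin, Finset.sum_range_succ, Finset.sum_range_zero]
    norm_num
    linear_combination (-2 / 15) * h2 + 1 / 15 * h3
  · norm_num [hvan, hS0, hS1, hS2, hS3] at h2 h3 h4
    simp only [XiCosm, Fintype.card_fin, Finset.sum_range_succ, Finset.sum_range_zero]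
    norm_num
    linear_combination (-8 / 189) * h2 + 6 / 189 * h3 - 1 / 189 * h4
end
end

section
/- There exists a rational constant c such that for every τ ∈ ℍ_4: Ξ^{(4)}(τ) = c·F_4(τ); in fact c = 12/7, i.e. Ξ^{(4)}(τ) = (12/7)·F_4(τ) for all τ ∈ ℍ_4. (This follows by eliminating S_{2,4}⁴, S_{3,2}⁴, S_{4,1}⁴ from Ξ^{(4)} using Igusa's three identities (2^8−1)S_{0,16}⁴ = 6S_{1,8}⁴ + 24S_{2,4}⁴, (2^6−1)S_{1,8}⁴ = 18S_{2,4}⁴ + 168S_{3,2}⁴ and (2^4−1)S_{2,4}⁴ = 42S_{3,2}⁴ + 840S_{4,1}⁴, and noting F_4 = 15·S_{0,16}⁴ − 2·S_{1,8}⁴.) -/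
open scoped BigOperators

noncomputable section

/-- The modular form `F_g(τ) = 2^g·Σ_m θ_m(τ)^{16} − (Σ_m θ_m(τ)^8)²`. -/
noncomputable def Fmod (ι : Type) [Fintype ι] [DecidableEq ι] (τ : Matrix ι ι ℂ) : ℂ :=
  2 ^ (Fintype.card ι) * ∑ m : Char2 ι, thetaConst m τ ^ 16 -
    (∑ m : Char2 ι, thetaConst m τ ^ 8) ^ 2

/-- Finite products of absolutely convergent series, expanded into a series over tuples. -/
theorem summable_norm_prod_and_prod_tsum {α : Type*} {n : ℕ} (f : Fin n → α → ℂ)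
    (hf : ∀ i, Summable fun a => ‖f i a‖) :
    (Summable fun a : Fin n → α => ‖∏ i, f i (a i)‖) ∧
      ∏ i, ∑' a, f i a = ∑' a : Fin n → α, ∏ i, f i (a i) := by
  induction n with
  | zero => exact ⟨Summable.of_finite, by simp [tsum_fintype]⟩
  | succ n ih =>
    obtain ⟨hs, ht⟩ := ih (fun i => f i.succ) fun i => hf i.succ
    let e := Fin.consEquiv fun _ : Fin (n + 1) => α
    have he : ∀ z : α × (Fin n → α), ∏ i, f i (e z i) = f 0 z.1 * ∏ i, f i.succ (z.2 i) :=
      fun z => by simp [e, Fin.prod_univ_succ, Fin.consEquiv]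
    constructor
    · rw [← e.summable_iff]
      refine ((hf 0).mul_of_nonneg hs (fun _ => norm_nonneg _) fun _ => norm_nonneg _).congr
        fun z => ?_
      simp only [Function.comp_apply, he, norm_mul]
    · rw [Fin.prod_univ_succ, ht, tsum_mul_tsum_of_summable_norm (hf 0) hs, ← e.tsum_eq]
      exact tsum_congr fun z => (he z).symm

theorem summable_norm_prod_pi {ι α : Type*} [Fintype ι] (f : ι → α → ℂ)
    (hf : ∀ i, Summable fun a => ‖f i a‖) :
    Summable fun a : ι → α => ‖∏ i, f i (a i)‖ := by
  let e := Fintype.equivFin ι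
  rw [← (Equiv.arrowCongr e.symm (Equiv.refl α)).summable_iff]
  refine (summable_norm_prod_and_prod_tsum (fun i => f (e.symm i)) fun i => hf _).1.congr
    fun a => ?_
  simp only [Function.comp_apply, Equiv.arrowCongr_apply, Equiv.symm_symm, Equiv.refl_apply]
  rw [← e.symm.prod_comp]
  simp

theorem prod_tsum_eq_tsum_prod_pi {ι α : Type*} [Fintype ι] (f : ι → α → ℂ)
    (hf : ∀ i, Summable fun a => ‖f i a‖) :
    ∏ i, ∑' a, f i a = ∑' a : ι → α, ∏ i, f i (a i) := by
  let e := Fintype.equivFin ι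
  rw [← (Equiv.arrowCongr e.symm (Equiv.refl α)).tsum_eq, ← e.symm.prod_comp,
    (summable_norm_prod_and_prod_tsum (fun i => f (e.symm i)) fun i => hf _).2]
  refine tsum_congr fun a => ?_
  simp only [Equiv.arrowCongr_apply, Equiv.symm_symm, Equiv.refl_apply, Function.comp_apply]
  rw [← e.symm.prod_comp]
  simp

theorem summable_exp_neg_mul_abs {c : ℝ} (hc : 0 < c) :
    Summable fun n : ℤ => Real.exp (-(c * |(n : ℝ)|)) := by
  have h : Summable fun n : ℕ => Real.exp (n * (-c)) :=
    Real.summable_exp_nat_mul_iff.2 (by linarith)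
  refine Summable.of_nat_of_neg (h.congr fun n => ?_) (h.congr fun n => ?_) <;>
    · congr 1
      simp
      ring

theorem Siegel.exists_coercive {ι : Type} [Fintype ι] {τ : Matrix ι ι ℂ} (hτ : τ ∈ Siegel ι) :
    ∃ c > 0, ∀ v : ι → ℝ, c * ∑ i, v i ^ 2 ≤ ∑ i, ∑ j, v i * (τ i j).im * v j := by
  have hcont : Continuous fun v : EuclideanSpace ℝ ι => ∑ i, ∑ j, v i * (τ i j).im * v j := by
    fun_prop
  have hpos : ∀ v : EuclideanSpace ℝ ι, v ≠ 0 → 0 < ∑ i, ∑ j, v i * (τ i j).im * v j :=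
    fun v hv => hτ.2 (fun i => v i) fun h => hv (by ext i; exact congrFun h i)
  obtain ⟨c, hc, hmin⟩ : ∃ c > 0, ∀ v ∈ Metric.sphere (0 : EuclideanSpace ℝ ι) 1,
      c ≤ ∑ i, ∑ j, v i * (τ i j).im * v j := by
    rcases (Metric.sphere (0 : EuclideanSpace ℝ ι) 1).eq_empty_or_nonempty with h | h
    · exact ⟨1, one_pos, by simp [h]⟩
    · obtain ⟨w, hw, hmin⟩ := (isCompact_sphere _ _).exists_isMinOn h hcont.continuousOn
      refine ⟨_, hpos w fun h0 => ?_, fun v hv => hmin hv⟩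
      simp [h0] at hw
  refine ⟨c, hc, fun v => ?_⟩
  let u : EuclideanSpace ℝ ι := WithLp.toLp 2 v
  have hnorm : ∑ i, v i ^ 2 = ‖u‖ ^ 2 := by
    simp [EuclideanSpace.norm_sq_eq, u]
  rw [hnorm]
  rcases eq_or_ne u 0 with hu | hu
  · have hv : v = 0 := by
      funext i
      exact congrArg (fun w : EuclideanSpace ℝ ι => w i) hu
    simp [hu, hv]
  · have hu' : 0 < ‖u‖ := norm_pos_iff.2 hu
    have h := hmin (‖u‖⁻¹ • u) (by simp [norm_smul, hu'.ne'])
    calc c * ‖u‖ ^ 2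
        ≤ (∑ i, ∑ j, (‖u‖⁻¹ • u) i * (τ i j).im * (‖u‖⁻¹ • u) j) * ‖u‖ ^ 2 := by gcongr
      _ = ∑ i, ∑ j, v i * (τ i j).im * v j := by
        have hui : ∀ i, u i = v i := fun _ => rfl
        simp only [Finset.sum_mul, PiLp.smul_apply, smul_eq_mul, hui]
        refine Finset.sum_congr rfl fun i _ => Finset.sum_congr rfl fun j _ => ?_
        field_simp

/-- The Gaussian `exp(πi·pᵀτp/4)` at an integral vector `p`. -/
def gaussTerm {ι : Type} [Fintype ι] (τ : Matrix ι ι ℂ) (p : ι → ℤ) : ℂ :=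
  Complex.exp (Real.pi * Complex.I / 4 * ∑ i, ∑ j, (p i : ℂ) * τ i j * (p j : ℂ))

theorem norm_gaussTerm {ι : Type} [Fintype ι] (τ : Matrix ι ι ℂ) (p : ι → ℤ) :
    ‖gaussTerm τ p‖ =
      Real.exp (-(Real.pi / 4 * ∑ i, ∑ j, (p i : ℝ) * (τ i j).im * (p j : ℝ))) := by
  have h : ∀ z : ℂ, (Real.pi * Complex.I / 4 * z).re = -(Real.pi / 4 * z.im) := fun z => by
    have : Real.pi * Complex.I / 4 * z = ((Real.pi / 4 : ℝ) : ℂ) * (Complex.I * z) := by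
      push_cast
      ring
    rw [this, Complex.re_ofReal_mul, Complex.I_mul_re]
    ring
  rw [gaussTerm, Complex.norm_exp, h]
  congr 3
  simp only [Complex.im_sum]
  refine Finset.sum_congr rfl fun i _ => Finset.sum_congr rfl fun j _ => ?_
  simp [Complex.mul_im, Complex.mul_re]

theorem summable_norm_gaussTerm {ι : Type} [Fintype ι] {τ : Matrix ι ι ℂ} (hτ : τ ∈ Siegel ι) :
    Summable fun p : ι → ℤ => ‖gaussTerm τ p‖ := by
  obtain ⟨c, hc, h⟩ := Siegel.exists_coercive hτ
  have hc' : 0 < Real.pi / 4 * c := by positivity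
  refine Summable.of_nonneg_of_le (fun _ => norm_nonneg _) (fun p => ?_)
    (summable_norm_prod_pi (fun (_ : ι) (n : ℤ) => (Real.exp (-(Real.pi / 4 * c * |(n : ℝ)|)) : ℂ))
      fun _ => (summable_exp_neg_mul_abs hc').congr fun n => ?_)
  · have hsq : ∑ i, |(p i : ℝ)| ≤ ∑ i, (p i : ℝ) ^ 2 := by
      refine Finset.sum_le_sum fun i _ => ?_
      rw [← sq_abs]
      exact_mod_cast Int.le_self_sq |p i|
    rw [norm_gaussTerm, ← Complex.ofReal_prod, ← Real.exp_sum,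
      Complex.norm_of_nonneg (Real.exp_pos _).le]
    refine Real.exp_le_exp.2 ?_
    rw [Finset.sum_neg_distrib, ← Finset.mul_sum, neg_le_neg_iff, mul_assoc]
    have := h fun i => (p i : ℝ)
    gcongr
    exact (mul_le_mul_of_nonneg_left hsq hc.le).trans this
  · rw [Complex.norm_of_nonneg (Real.exp_pos _).le]

/-- The integral vector `2(n + ε/2)`. -/
def shiftVec {ι : Type} (ε : ι → ZMod 2) (n : ι → ℤ) (i : ι) : ℤ := 2 * n i + (ε i).val

theorem shiftVec_injective {ι : Type} (ε : ι → ZMod 2) : Function.Injective (shiftVec ε) := by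
  intro n n' h
  funext i
  have := congrFun h i
  simp only [shiftVec] at this
  omega

theorem Complex.exp_pi_mul_I_div_two_mul_int (n : ℤ) :
    Complex.exp (Real.pi * Complex.I / 2 * n) = Complex.I ^ n := by
  rw [mul_comm, Complex.exp_int_mul, mul_div_right_comm, Complex.exp_pi_div_two_mul_I]

/-- The general term of the theta constants with second characteristic `δ`, at the vector `p`. -/
def thetaTerm {ι : Type} [Fintype ι] (τ : Matrix ι ι ℂ) (δ : ι → ZMod 2) (p : ι → ℤ) : ℂ :=
  gaussTerm τ p * ∏ i, Complex.I ^ (p i * ((δ i).val : ℤ))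

theorem norm_thetaTerm {ι : Type} [Fintype ι] (τ : Matrix ι ι ℂ) (δ : ι → ZMod 2) (p : ι → ℤ) :
    ‖thetaTerm τ δ p‖ = ‖gaussTerm τ p‖ := by
  simp [thetaTerm]

theorem thetaConst_eq_tsum {ι : Type} [Fintype ι] (m : Char2 ι) (τ : Matrix ι ι ℂ) :
    thetaConst m τ = ∑' n : ι → ℤ, thetaTerm τ m.2 (shiftVec m.1 n) := by
  refine tsum_congr fun n => ?_
  simp only [thetaTerm, gaussTerm, ← Complex.exp_pi_mul_I_div_two_mul_int]
  rw [← Complex.exp_sum, ← Complex.exp_add, ← Finset.mul_sum]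
  congr 1
  simp only [mul_add, Finset.mul_sum]
  congr 1
  · refine Finset.sum_congr rfl fun i _ => Finset.sum_congr rfl fun j _ => ?_
    simp only [shiftVec]
    push_cast
    ring
  · refine Finset.sum_congr rfl fun i _ => ?_
    simp only [shiftVec, Pi.zero_apply]
    push_cast
    ring

theorem summable_norm_thetaTerm {ι : Type} [Fintype ι] {τ : Matrix ι ι ℂ} (hτ : τ ∈ Siegel ι)
    (m : Char2 ι) : Summable fun n : ι → ℤ => ‖thetaTerm τ m.2 (shiftVec m.1 n)‖ := by
  simp only [norm_thetaTerm]
  exact (summable_norm_gaussTerm hτ).comp_injective (shiftVec_injective m.1)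

/-- The group of affine functions in `i` variables over `𝔽₂`, as (constant term, linear part). -/
abbrev AffCoeff (i : ℕ) := ZMod 2 × (Fin i → ZMod 2)

/-- The word of length `X` obtained by evaluating an affine function along `g`. -/
def codeword {X : Type} {i : ℕ} (g : X → Fin i → ZMod 2) (κ : AffCoeff i) (x : X) : ZMod 2 :=
  κ.1 + ∑ j, g x j * κ.2 j

theorem codeword_add {X : Type} {i : ℕ} (g : X → Fin i → ZMod 2) (κ κ' : AffCoeff i) (x : X) :
    codeword g (κ + κ') x = codeword g κ x + codeword g κ' x := by
  simp only [codeword, Prod.fst_add, Prod.snd_add, Pi.add_apply, mul_add, Finset.sum_add_distrib]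
  ring

theorem codeword_zero {X : Type} {i : ℕ} (g : X → Fin i → ZMod 2) (x : X) :
    codeword g 0 x = 0 := by
  simp [codeword]

theorem codeword_injective {X : Type} {i : ℕ} {g : X → Fin i → ZMod 2}
    (hg : Function.Surjective g) : Function.Injective (codeword g) := by
  intro κ κ' h
  obtain ⟨x₀, hx₀⟩ := hg 0
  have h₀ : κ.1 = κ'.1 := by simpa [codeword, hx₀] using congrFun h x₀
  refine Prod.ext h₀ (funext fun j => ?_)
  obtain ⟨x, hx⟩ := hg (Pi.single j 1)
  have := congrFun h x
  simp only [codeword, hx, h₀] at this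
  simpa [Pi.single_apply] using this

/-- The condition on `g` making the pairing with codewords a character of the group of
codewords: codewords are triply orthogonal. -/
def TriplyOrthogonal {X : Type} [Fintype X] {i : ℕ} (g : X → Fin i → ZMod 2) : Prop :=
  ∀ κ μ ν : AffCoeff i, ∑ x, codeword g κ x * codeword g μ x * codeword g ν x = 0

/-- The pairing of an integral vector with a codeword. -/
def codePairing {X : Type} [Fintype X] {i : ℕ} (g : X → Fin i → ZMod 2) (P : X → ℤ)
    (κ : AffCoeff i) : ℤ :=
  ∑ x, P x * ((codeword g κ x).val : ℤ)

/-- The vectors which reduce to a codeword modulo 2. -/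
def ReducesToCode {X : Type} {i : ℕ} (g : X → Fin i → ZMod 2) (P : X → ℤ) : Prop :=
  ∃ κ, ∀ x, (P x : ZMod 2) = codeword g κ x

theorem ZMod.val_two_add (a b : ZMod 2) :
    (((a + b).val : ℕ) : ℤ) = a.val + b.val - 2 * (a.val * b.val) := by
  revert a b
  decide

theorem codePairing_add {X : Type} [Fintype X] {i : ℕ} {g : X → Fin i → ZMod 2}
    (hg : TriplyOrthogonal g) {P : X → ℤ} (hP : ReducesToCode g P) (κ κ' : AffCoeff i) :
    ∃ t, codePairing g P (κ + κ') = codePairing g P κ + codePairing g P κ' + 4 * t := by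
  obtain ⟨μ, hμ⟩ := hP
  have h2 : (2 : ℤ) ∣ ∑ x, P x * ((codeword g κ x).val * (codeword g κ' x).val : ℤ) := by
    rw [← Nat.cast_ofNat, ← ZMod.intCast_zmod_eq_zero_iff_dvd, ← hg μ κ κ']
    push_cast
    refine Finset.sum_congr rfl fun x _ => ?_
    rw [hμ, ZMod.natCast_zmod_val, ZMod.natCast_zmod_val]
    ring
  obtain ⟨t, ht⟩ := h2
  refine ⟨-t, ?_⟩
  have : codePairing g P (κ + κ') = codePairing g P κ + codePairing g P κ' -
      2 * ∑ x, P x * ((codeword g κ x).val * (codeword g κ' x).val : ℤ) := by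
    simp only [codePairing, codeword_add, ZMod.val_two_add, Finset.mul_sum,
      ← Finset.sum_add_distrib, ← Finset.sum_sub_distrib]
    exact Finset.sum_congr rfl fun x _ => by ring
  rw [this, ht]
  ring

theorem Complex.I_zpow_eq_one_iff (n : ℤ) : Complex.I ^ n = 1 ↔ (4 : ℤ) ∣ n := by
  have hp : IsPrimitiveRoot Complex.I 4 := by
    refine (IsPrimitiveRoot.iff_orderOf (ζ := Complex.I) (k := 4)).2 ?_
    rw [orderOf_eq_iff (by norm_num)]
    refine ⟨Complex.I_pow_four, fun m hm hm0 => ?_⟩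
    interval_cases m
    · simpa using fun h => by simpa using congrArg Complex.re h
    · rw [Complex.I_sq]; norm_num
    · rw [Complex.I_pow_three]
      exact fun h => by simpa using congrArg Complex.re h
  exact_mod_cast hp.zpow_eq_one_iff_dvd n

theorem sum_I_zpow_codePairing {X : Type} [Fintype X] {i : ℕ} {g : X → Fin i → ZMod 2}
    (hg : TriplyOrthogonal g) {P : X → ℤ} (hP : ReducesToCode g P)
    [Decidable (∀ κ, (4 : ℤ) ∣ codePairing g P κ)] :
    ∑ κ, Complex.I ^ codePairing g P κ =
      if ∀ κ, (4 : ℤ) ∣ codePairing g P κ then (2 : ℂ) ^ (i + 1) else 0 := by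
  classical
  let ψ : AddChar (AffCoeff i) ℂ :=
    { toFun := fun κ => Complex.I ^ codePairing g P κ
      map_zero_eq_one' := by simp [codePairing, codeword_zero]
      map_add_eq_mul' := fun κ κ' => by
        obtain ⟨t, ht⟩ := codePairing_add hg hP κ κ'
        rw [ht, zpow_add₀ Complex.I_ne_zero, zpow_add₀ Complex.I_ne_zero,
          (Complex.I_zpow_eq_one_iff (4 * t)).2 ⟨t, rfl⟩, mul_one] }
  have hψ : ψ = 0 ↔ ∀ κ, (4 : ℤ) ∣ codePairing g P κ := by
    simp only [← Complex.I_zpow_eq_one_iff]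
    exact ⟨fun h κ => DFunLike.congr_fun h κ, fun h => by ext κ; exact h κ⟩
  have hcard : (Fintype.card (AffCoeff i) : ℂ) = 2 ^ (i + 1) := by
    simp [pow_succ, mul_comm]
  have := AddChar.sum_eq_ite ψ
  rw [hcard] at this
  simp only [hψ] at this
  convert this using 1
  rfl

theorem Complex.I_zpow_sum {X : Type} [Fintype X] (s : X → ℤ) :
    Complex.I ^ (∑ x, s x) = ∏ x, Complex.I ^ s x := by
  classical
  induction (Finset.univ : Finset X) using Finset.induction_on with
  | empty => simp
  | insert x t hx ih =>
    rw [Finset.sum_insert hx, Finset.prod_insert hx, zpow_add₀ Complex.I_ne_zero, ih]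

/-- The lattice attached to the code of affine functions along `g`, scaled by 2. -/
def codeLattice {X : Type} [Fintype X] {i : ℕ} (g : X → Fin i → ZMod 2) : Set (X → ℤ) :=
  {P | ReducesToCode g P ∧ ∀ κ, (4 : ℤ) ∣ codePairing g P κ}

/-- The general term of the theta series of a lattice, at a tuple `P` of lattice vectors. -/
def latticeTerm {ι X : Type} [Fintype ι] [Fintype X] (τ : Matrix ι ι ℂ) (P : ι → X → ℤ) : ℂ :=
  ∏ x, gaussTerm τ fun k => P k x

/-- The theta series of a lattice scaled by 2. -/
def latticeTheta {ι X : Type} [Fintype ι] [Fintype X] (τ : Matrix ι ι ℂ) (L : Set (X → ℤ)) : ℂ :=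
  ∑' P : {P : ι → X → ℤ // ∀ k, P k ∈ L}, latticeTerm τ P.1

theorem summable_latticeTerm {ι X : Type} [Fintype ι] [Fintype X] {τ : Matrix ι ι ℂ}
    (hτ : τ ∈ Siegel ι) : Summable fun P : ι → X → ℤ => latticeTerm τ P := by
  have h := (summable_norm_prod_pi (fun (_ : X) p => gaussTerm τ p)
    fun _ => summable_norm_gaussTerm hτ).of_norm
  exact ((Equiv.piComm fun (_ : ι) (_ : X) => ℤ).summable_iff.2 h).congr fun P => rfl

/-- The tuple of vectors with given codewords as residues modulo 2. -/
def liftTuple {ι X : Type} {i : ℕ} (g : X → Fin i → ZMod 2)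
    (en : (ι → AffCoeff i) × (X → ι → ℤ)) (k : ι) (x : X) : ℤ :=
  shiftVec (fun k => codeword g (en.1 k) x) (en.2 x) k

theorem liftTuple_cast {ι X : Type} {i : ℕ} (g : X → Fin i → ZMod 2)
    (en : (ι → AffCoeff i) × (X → ι → ℤ)) (k : ι) (x : X) :
    (liftTuple g en k x : ZMod 2) = codeword g (en.1 k) x := by
  have h2 : (2 : ZMod 2) = 0 := rfl
  simp only [liftTuple, shiftVec, Int.cast_add, Int.cast_mul, Int.cast_ofNat, h2, zero_mul,
    zero_add, Int.cast_natCast, ZMod.natCast_zmod_val]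

theorem reducesToCode_liftTuple {ι X : Type} {i : ℕ} (g : X → Fin i → ZMod 2)
    (en : (ι → AffCoeff i) × (X → ι → ℤ)) (k : ι) : ReducesToCode g (liftTuple g en k) :=
  ⟨en.1 k, liftTuple_cast g en k⟩

theorem liftTuple_injective {ι X : Type} {i : ℕ} {g : X → Fin i → ZMod 2}
    (hg : Function.Surjective g) :
    Function.Injective (liftTuple g : (ι → AffCoeff i) × (X → ι → ℤ) → ι → X → ℤ) := by
  rintro ⟨e, n⟩ ⟨e', n'⟩ h
  have he : e = e' := by
    funext k
    refine codeword_injective hg (funext fun x => ?_)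
    rw [← liftTuple_cast g (e, n) k x, h, liftTuple_cast]
  subst he
  refine Prod.ext rfl (funext fun x =>
    shiftVec_injective (fun k => codeword g (e k) x) (funext fun k => ?_))
  exact congrFun (congrFun h k) x

theorem exists_liftTuple_eq {ι X : Type} {i : ℕ} {g : X → Fin i → ZMod 2} {P : ι → X → ℤ}
    (hP : ∀ k, ReducesToCode g (P k)) : ∃ en, liftTuple g en = P := by
  choose e he using hP
  refine ⟨(e, fun x k => P k x / 2), funext fun k => funext fun x => ?_⟩
  have h : ((P k x % 2 : ℤ) : ZMod 2) = (((codeword g (e k) x).val : ℤ) : ZMod 2) := by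
    rw [← he k x, ← ZMod.intCast_mod (P k x) 2, Int.cast_natCast, ZMod.natCast_zmod_val]
    rfl
  have hlt := (codeword g (e k) x).val_lt
  rw [ZMod.intCast_eq_intCast_iff'] at h
  simp only [liftTuple, shiftVec]
  push_cast at h
  omega

theorem sum_prod_thetaConst_eq_latticeTheta {ι X : Type} [Fintype ι] [DecidableEq ι] [Fintype X]
    {τ : Matrix ι ι ℂ} (hτ : τ ∈ Siegel ι) {i : ℕ} {g : X → Fin i → ZMod 2}
    (hsurj : Function.Surjective g) (hg : TriplyOrthogonal g) :
    ∑ e : ι → AffCoeff i, ∑ d : ι → AffCoeff i,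
        ∏ x, thetaConst (fun k => codeword g (e k) x, fun k => codeword g (d k) x) τ =
      (2 ^ (i + 1)) ^ Fintype.card ι * latticeTheta τ (codeLattice g) := by
  classical
  let F : (ι → X → ℤ) → ℂ :=
    Set.indicator {P | ∀ k, P k ∈ codeLattice g} fun P => latticeTerm τ P
  have hF : Summable F := (summable_latticeTerm hτ).indicator _
  have hinner : ∀ e : ι → AffCoeff i, ∑ d : ι → AffCoeff i,
      ∏ x, thetaConst (fun k => codeword g (e k) x, fun k => codeword g (d k) x) τ =
      ∑' n : X → ι → ℤ, (2 ^ (i + 1)) ^ Fintype.card ι * F (liftTuple g (e, n)) := by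
    intro e
    simp only [thetaConst_eq_tsum]
    have hs : ∀ (d : ι → AffCoeff i) (x : X), Summable fun n : ι → ℤ =>
        ‖thetaTerm τ (fun k => codeword g (d k) x)
          (shiftVec (fun k => codeword g (e k) x) n)‖ := fun d x =>
      summable_norm_thetaTerm hτ (fun k => codeword g (e k) x, fun k => codeword g (d k) x)
    rw [Finset.sum_congr rfl fun d _ => prod_tsum_eq_tsum_prod_pi _ (hs d),
      ← Summable.tsum_finsetSum fun d _ => (summable_norm_prod_pi _ (hs d)).of_norm]
    refine tsum_congr fun n => ?_
    set P := liftTuple g (e, n) with hPdef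
    have hP : ∀ k, ReducesToCode g (P k) := reducesToCode_liftTuple g (e, n)
    calc _ = ∑ d : ι → AffCoeff i,
          latticeTerm τ P * ∏ k, Complex.I ^ codePairing g (P k) (d k) := by
          refine Finset.sum_congr rfl fun d _ => ?_
          simp only [thetaTerm, Finset.prod_mul_distrib, latticeTerm, codePairing]
          congr 1
          rw [Finset.prod_comm]
          refine Finset.prod_congr rfl fun k _ => ?_
          exact (Complex.I_zpow_sum _).symm
      _ = latticeTerm τ P * ∏ k, ∑ κ, Complex.I ^ codePairing g (P k) κ := by
          rw [← Finset.mul_sum, Finset.prod_univ_sum, Fintype.piFinset_univ]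
      _ = _ := by
          simp only [sum_I_zpow_codePairing hg (hP _)]
          by_cases h : ∀ k, P k ∈ codeLattice g
          · rw [show F P = latticeTerm τ P from if_pos h,
              Finset.prod_congr rfl fun k _ => if_pos (h k).2]
            simp [mul_comm]
          · rw [show F P = 0 from if_neg h]
            push Not at h
            obtain ⟨k, hk⟩ := h
            rw [Finset.prod_eq_zero (Finset.mem_univ k) (if_neg fun h => hk ⟨hP k, h⟩)]
            simp
  have hinj := liftTuple_injective (ι := ι) hsurj
  have hsum : Summable fun en => (2 ^ (i + 1)) ^ Fintype.card ι * F (liftTuple g en) :=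
    (hF.comp_injective hinj).mul_left _
  rw [Finset.sum_congr rfl fun e _ => hinner e, ← tsum_fintype (L := .unconditional _),
    ← hsum.tsum_prod, tsum_mul_left, hinj.tsum_eq, latticeTheta]
  · exact congrArg _ (tsum_subtype {P : ι → X → ℤ | ∀ k, P k ∈ codeLattice g} _).symm
  · intro P hP
    have : ∀ k, P k ∈ codeLattice g := Set.mem_of_indicator_ne_zero hP
    exact exists_liftTuple_eq fun k => (this k).1

theorem AffCoeff.induction {i : ℕ} {p : AffCoeff i → Prop} (zero : p 0) (one : p (1, 0))
    (single : ∀ j, p (0, Pi.single j 1)) (hadd : ∀ κ κ', p κ → p κ' → p (κ + κ'))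
    (κ : AffCoeff i) : p κ := by
  have h01 : ∀ a : ZMod 2, a = 0 ∨ a = 1 := by decide
  have hκ : κ = (κ.1, 0) + ∑ j, ((0, Pi.single j (κ.2 j)) : AffCoeff i) := by
    refine Prod.ext (by simp [Prod.fst_sum]) ?_
    simp [Prod.snd_sum, Finset.univ_sum_single]
  rw [hκ]
  refine hadd _ _ ?_ (Finset.sum_induction _ p (fun _ _ => hadd _ _) zero fun j _ => ?_)
  · rcases h01 κ.1 with h | h <;> rw [h]
    exacts [zero, one]
  · rcases h01 (κ.2 j) with h | h <;> rw [h]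
    · rw [Pi.single_zero]
      exact zero
    · exact single j

theorem mem_codeLattice_iff {X : Type} [Fintype X] {i : ℕ} {g : X → Fin i → ZMod 2}
    (hg : TriplyOrthogonal g) (P : X → ℤ) : P ∈ codeLattice g ↔
      (∃ (c : ℤ) (w : Fin i → ℤ), ∀ x, (2 : ℤ) ∣ P x - (c + ∑ j, ((g x j).val : ℤ) * w j)) ∧
        (4 : ℤ) ∣ ∑ x, P x ∧ ∀ j, (4 : ℤ) ∣ ∑ x, P x * ((g x j).val : ℤ) := by
  have hone : codePairing g P (1, 0) = ∑ x, P x := by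
    simp [codePairing, codeword, ZMod.val_one]
  have hsingle : ∀ j, codePairing g P (0, Pi.single j 1) = ∑ x, P x * ((g x j).val : ℤ) := by
    intro j
    simp [codePairing, codeword, Pi.single_apply]
  have hdvd : ∀ (a b : ℤ), (2 : ℤ) ∣ a - b ↔ (a : ZMod 2) = (b : ZMod 2) := fun a b => by
    rw [← sub_eq_zero, ← Int.cast_sub, ZMod.intCast_zmod_eq_zero_iff_dvd, Nat.cast_ofNat]
  simp only [hdvd]
  push_cast
  simp only [ZMod.natCast_zmod_val]
  constructor
  · rintro ⟨⟨κ, hκ⟩, h4⟩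
    refine ⟨⟨κ.1.val, fun j => (κ.2 j).val, fun x => ?_⟩, hone ▸ h4 _, fun j => hsingle j ▸ h4 _⟩
    simp [hκ, codeword]
  · rintro ⟨⟨c, w, h⟩, h1, h2⟩
    have hP : ReducesToCode g P := ⟨(c, fun j => w j), h⟩
    refine ⟨hP, AffCoeff.induction ?_ (hone ▸ h1) (fun j => hsingle j ▸ h2 j) fun κ κ' hκ hκ' => ?_⟩
    · simp [codePairing, codeword_zero]
    · obtain ⟨t, ht⟩ := codePairing_add hg hP κ κ'
      rw [ht]
      exact dvd_add (dvd_add hκ hκ') (dvd_mul_right _ _)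

/-- Sixteen points, in four blocks of four. -/
abbrev Pt := Fin 4 × Fin 4

/-- The Sylvester–Hadamard matrix of order four. -/
def hadamard : Matrix (Fin 4) (Fin 4) ℤ :=
  !![1, 1, 1, 1; 1, -1, 1, -1; 1, 1, -1, -1; 1, -1, -1, 1]

/-- The Hadamard matrix applied to each block of an integral vector. -/
def hadamardSum (P : Pt → ℤ) (x : Pt) : ℤ := ∑ y, hadamard x.2 y * P (x.1, y)

/-- Half of `hadamardSum` is defined on `L` and takes values in `L'`. -/
def HalfHadamardMapsTo (L L' : Set (Pt → ℤ)) : Prop :=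
  ∀ P ∈ L, (∀ x, 2 ∣ hadamardSum P x) ∧
    ∀ Q : Pt → ℤ, (∀ x, 2 * Q x = hadamardSum P x) → Q ∈ L'

/-- The orthogonal transformation of each block by half the Hadamard matrix. -/
def halfHadamard (P : Pt → ℤ) (x : Pt) : ℤ := hadamardSum P x / 2

namespace HalfHadamardMapsTo

variable {L L' : Set (Pt → ℤ)} {P : Pt → ℤ}

theorem two_mul_halfHadamard (h : HalfHadamardMapsTo L L') (hP : P ∈ L) (x : Pt) :
    2 * halfHadamard P x = hadamardSum P x :=
  Int.mul_ediv_cancel' ((h P hP).1 x)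

theorem halfHadamard_mem (h : HalfHadamardMapsTo L L') (hP : P ∈ L) : halfHadamard P ∈ L' :=
  (h P hP).2 _ (h.two_mul_halfHadamard hP)

theorem halfHadamard_halfHadamard (h : HalfHadamardMapsTo L L') (h' : HalfHadamardMapsTo L' L)
    (hP : P ∈ L) : halfHadamard (halfHadamard P) = P := by
  funext ⟨u, y⟩
  have h2 := h'.two_mul_halfHadamard (h.halfHadamard_mem hP) (u, y)
  have h1 : ∀ y, 2 * halfHadamard P (u, y) = hadamardSum P (u, y) :=
    fun y => h.two_mul_halfHadamard hP (u, y)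
  have h10 := h1 0
  have h11 := h1 1
  have h12 := h1 2
  have h13 := h1 3
  revert h2
  generalize halfHadamard (halfHadamard P) (u, y) = z
  intro h2
  fin_cases y <;> simp [hadamardSum, hadamard, Fin.sum_univ_four] at * <;> linarith

theorem sum_mul_halfHadamard (h : HalfHadamardMapsTo L L') {P' : Pt → ℤ} (hP : P ∈ L)
    (hP' : P' ∈ L) : ∑ x, halfHadamard P x * halfHadamard P' x = ∑ x, P x * P' x := by
  have h4 : 4 * ∑ x, halfHadamard P x * halfHadamard P' x =
      ∑ x, hadamardSum P x * hadamardSum P' x := by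
    rw [Finset.mul_sum]
    refine Finset.sum_congr rfl fun x _ => ?_
    rw [← h.two_mul_halfHadamard hP, ← h.two_mul_halfHadamard hP']
    ring
  have h4' : ∑ x, hadamardSum P x * hadamardSum P' x = 4 * ∑ x, P x * P' x := by
    rw [Finset.mul_sum, Fintype.sum_prod_type, Fintype.sum_prod_type]
    refine Finset.sum_congr rfl fun u _ => ?_
    simp [hadamardSum, hadamard, Fin.sum_univ_four]
    ring
  linarith

end HalfHadamardMapsTo

theorem latticeTerm_eq {ι X : Type} [Fintype ι] [Fintype X] (τ : Matrix ι ι ℂ) (P : ι → X → ℤ) :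
    latticeTerm τ P = Complex.exp (Real.pi * Complex.I / 4 *
      ∑ k, ∑ l, τ k l * ((∑ x, P k x * P l x : ℤ) : ℂ)) := by
  simp only [latticeTerm, gaussTerm, ← Complex.exp_sum, ← Finset.mul_sum]
  congr 2
  rw [Finset.sum_comm]
  refine Finset.sum_congr rfl fun k _ => ?_
  rw [Finset.sum_comm]
  refine Finset.sum_congr rfl fun l _ => ?_
  push_cast
  rw [Finset.mul_sum]
  exact Finset.sum_congr rfl fun x _ => by ring

theorem latticeTheta_eq_of_halfHadamard {ι : Type} [Fintype ι] (τ : Matrix ι ι ℂ)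
    {L L' : Set (Pt → ℤ)} (h : HalfHadamardMapsTo L L') (h' : HalfHadamardMapsTo L' L) :
    latticeTheta τ L = latticeTheta τ L' := by
  let e : {P : ι → Pt → ℤ // ∀ k, P k ∈ L} ≃ {P : ι → Pt → ℤ // ∀ k, P k ∈ L'} :=
    { toFun := fun P => ⟨fun k => halfHadamard (P.1 k), fun k => h.halfHadamard_mem (P.2 k)⟩
      invFun := fun P => ⟨fun k => halfHadamard (P.1 k), fun k => h'.halfHadamard_mem (P.2 k)⟩
      left_inv := fun P => Subtype.ext (funext fun k => h.halfHadamard_halfHadamard h' (P.2 k))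
      right_inv := fun P => Subtype.ext (funext fun k => h'.halfHadamard_halfHadamard h (P.2 k)) }
  rw [latticeTheta, latticeTheta, ← e.tsum_eq]
  refine tsum_congr fun P => ?_
  rw [latticeTerm_eq, latticeTerm_eq]
  simp only [e, Equiv.coe_fn_mk, h.sum_mul_halfHadamard (P.2 _) (P.2 _)]

/-- The low binary digit. -/
def lowBit (y : Fin 4) : ZMod 2 := ![0, 1, 0, 1] y

/-- The high binary digit. -/
def highBit (y : Fin 4) : ZMod 2 := ![0, 0, 1, 1] y

/-- The empty list of coordinates on `Pt`; its code is the repetition code. -/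
def coord₀ (_ : Pt) : Fin 0 → ZMod 2 := ![]

/-- One coordinate inside the blocks. -/
def coord₁ (x : Pt) : Fin 1 → ZMod 2 := ![lowBit x.2]

/-- Both coordinates inside the blocks. -/
def coord₂ (x : Pt) : Fin 2 → ZMod 2 := ![lowBit x.2, highBit x.2]

/-- Both coordinates of the block. -/
def blockCoord₂ (x : Pt) : Fin 2 → ZMod 2 := ![lowBit x.1, highBit x.1]

/-- One coordinate inside the blocks and both coordinates of the block. -/
def coord₃ (x : Pt) : Fin 3 → ZMod 2 := ![highBit x.2, lowBit x.1, highBit x.1]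

/-- All four coordinates on `Pt`. -/
def coord₄ (x : Pt) : Fin 4 → ZMod 2 := ![lowBit x.2, highBit x.2, lowBit x.1, highBit x.1]

theorem triplyOrthogonal_coord₀ : TriplyOrthogonal coord₀ := by
  intro κ μ ν
  simp only [codeword, Fintype.sum_prod_type, Fin.sum_univ_succ, coord₀]
  simp
  grind

theorem triplyOrthogonal_coord₁ : TriplyOrthogonal coord₁ := by
  intro κ μ ν
  simp only [codeword, Fintype.sum_prod_type, Fin.sum_univ_succ, coord₁, lowBit]
  simp
  grind

theorem triplyOrthogonal_coord₂ : TriplyOrthogonal coord₂ := by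
  intro κ μ ν
  simp only [codeword, Fintype.sum_prod_type, Fin.sum_univ_succ, coord₂, lowBit, highBit]
  simp
  grind

theorem triplyOrthogonal_blockCoord₂ : TriplyOrthogonal blockCoord₂ := by
  intro κ μ ν
  simp only [codeword, Fintype.sum_prod_type, Fin.sum_univ_succ, blockCoord₂, lowBit, highBit]
  simp
  grind

theorem triplyOrthogonal_coord₃ : TriplyOrthogonal coord₃ := by
  intro κ μ ν
  simp only [codeword, Fintype.sum_prod_type, Fin.sum_univ_succ, coord₃, lowBit, highBit]
  simp
  grind

theorem triplyOrthogonal_coord₄ : TriplyOrthogonal coord₄ := by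
  intro κ μ ν
  simp only [codeword, Fintype.sum_prod_type, Fin.sum_univ_succ, coord₄, lowBit, highBit]
  simp
  grind

theorem intCast_one_zmod_two : ((1 : ZMod 2).cast : ℤ) = 1 := rfl

theorem exists_eq_of_mem_codeLattice {X : Type} [Fintype X] {i : ℕ} {g : X → Fin i → ZMod 2}
    (hg : TriplyOrthogonal g) {P : X → ℤ} (hP : P ∈ codeLattice g) :
    ∃ (c : ℤ) (w : Fin i → ℤ) (n : X → ℤ),
      ∀ x, P x = 2 * n x + (c + ∑ j, ((g x j).val : ℤ) * w j) := by
  obtain ⟨c, w, h⟩ := ((mem_codeLattice_iff hg P).1 hP).1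
  choose n hn using h
  exact ⟨c, w, n, fun x => by linarith [hn x]⟩

set_option maxHeartbeats 1000000 in
theorem halfHadamardMapsTo_coord₀_blockCoord₂ :
    HalfHadamardMapsTo (codeLattice coord₀) (codeLattice blockCoord₂) := by
  intro P hP
  obtain ⟨c, w, n, hn⟩ := exists_eq_of_mem_codeLattice triplyOrthogonal_coord₀ hP
  obtain ⟨-, hsum, hcoord⟩ := (mem_codeLattice_iff triplyOrthogonal_coord₀ P).1 hP
  simp [hn, hadamardSum, hadamard, Fin.forall_fin_succ, Fintype.sum_prod_type, Fin.sum_univ_succ,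
    coord₀] at hsum hcoord ⊢
  refine ⟨by lia, ?_⟩
  intro Q
  intros
  refine (mem_codeLattice_iff triplyOrthogonal_blockCoord₂ Q).2 ⟨⟨Q (0, 0),
    ![Q (1, 0) - Q (0, 0), Q (2, 0) - Q (0, 0)], ?_⟩, ?_⟩
  · simp [Fin.forall_fin_succ, Fin.sum_univ_succ, blockCoord₂, lowBit, highBit,
      intCast_one_zmod_two]
    and_intros <;> lia
  · simp [Fintype.sum_prod_type, Fin.forall_fin_succ, Fin.sum_univ_succ, blockCoord₂, lowBit,
      highBit, intCast_one_zmod_two]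
    and_intros <;> lia

set_option maxHeartbeats 1000000 in
theorem halfHadamardMapsTo_blockCoord₂_coord₀ :
    HalfHadamardMapsTo (codeLattice blockCoord₂) (codeLattice coord₀) := by
  intro P hP
  obtain ⟨c, w, n, hn⟩ := exists_eq_of_mem_codeLattice triplyOrthogonal_blockCoord₂ hP
  obtain ⟨-, hsum, hcoord⟩ := (mem_codeLattice_iff triplyOrthogonal_blockCoord₂ P).1 hP
  simp [hn, hadamardSum, hadamard, Fin.forall_fin_succ, Fintype.sum_prod_type, Fin.sum_univ_succ,
    blockCoord₂, lowBit, highBit, intCast_one_zmod_two] at hsum hcoord ⊢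
  refine ⟨by lia, ?_⟩
  intro Q
  intros
  refine (mem_codeLattice_iff triplyOrthogonal_coord₀ Q).2 ⟨⟨Q (0, 0),
    ![], ?_⟩, ?_⟩
  · simp [Fin.forall_fin_succ, coord₀]
    and_intros <;> lia
  · simp [Fintype.sum_prod_type, Fin.sum_univ_succ, coord₀]
    lia

set_option maxHeartbeats 1000000 in
theorem halfHadamardMapsTo_coord₁_coord₃ :
    HalfHadamardMapsTo (codeLattice coord₁) (codeLattice coord₃) := by
  intro P hP
  obtain ⟨c, w, n, hn⟩ := exists_eq_of_mem_codeLattice triplyOrthogonal_coord₁ hP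
  obtain ⟨-, hsum, hcoord⟩ := (mem_codeLattice_iff triplyOrthogonal_coord₁ P).1 hP
  simp [hn, hadamardSum, hadamard, Fin.forall_fin_succ, Fintype.sum_prod_type, Fin.sum_univ_succ,
    coord₁, lowBit, intCast_one_zmod_two] at hsum hcoord ⊢
  refine ⟨by lia, ?_⟩
  intro Q
  intros
  refine (mem_codeLattice_iff triplyOrthogonal_coord₃ Q).2 ⟨⟨Q (0, 0),
    ![Q (0, 2) - Q (0, 0), Q (1, 0) - Q (0, 0), Q (2, 0) - Q (0, 0)], ?_⟩, ?_⟩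
  · simp [Fin.forall_fin_succ, Fin.sum_univ_succ, coord₃, lowBit, highBit, intCast_one_zmod_two]
    and_intros <;> lia
  · simp [Fintype.sum_prod_type, Fin.forall_fin_succ, Fin.sum_univ_succ, coord₃, lowBit, highBit,
      intCast_one_zmod_two]
    and_intros <;> lia

set_option maxHeartbeats 1000000 in
theorem halfHadamardMapsTo_coord₃_coord₁ :
    HalfHadamardMapsTo (codeLattice coord₃) (codeLattice coord₁) := by
  intro P hP
  obtain ⟨c, w, n, hn⟩ := exists_eq_of_mem_codeLattice triplyOrthogonal_coord₃ hP
  obtain ⟨-, hsum, hcoord⟩ := (mem_codeLattice_iff triplyOrthogonal_coord₃ P).1 hP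
  simp [hn, hadamardSum, hadamard, Fin.forall_fin_succ, Fintype.sum_prod_type, Fin.sum_univ_succ,
    coord₃, lowBit, highBit, intCast_one_zmod_two] at hsum hcoord ⊢
  refine ⟨by lia, ?_⟩
  intro Q
  intros
  refine (mem_codeLattice_iff triplyOrthogonal_coord₁ Q).2 ⟨⟨Q (0, 0),
    ![Q (0, 1) - Q (0, 0)], ?_⟩, ?_⟩
  · simp [Fin.forall_fin_succ, coord₁, lowBit, intCast_one_zmod_two]
    and_intros <;> lia
  · simp [Fintype.sum_prod_type, Fin.sum_univ_succ, coord₁, lowBit, intCast_one_zmod_two]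
    and_intros <;> lia

set_option maxHeartbeats 1000000 in
theorem halfHadamardMapsTo_coord₂_coord₄ :
    HalfHadamardMapsTo (codeLattice coord₂) (codeLattice coord₄) := by
  intro P hP
  obtain ⟨c, w, n, hn⟩ := exists_eq_of_mem_codeLattice triplyOrthogonal_coord₂ hP
  obtain ⟨-, hsum, hcoord⟩ := (mem_codeLattice_iff triplyOrthogonal_coord₂ P).1 hP
  simp [hn, hadamardSum, hadamard, Fin.forall_fin_succ, Fintype.sum_prod_type, Fin.sum_univ_succ,
    coord₂, lowBit, highBit, intCast_one_zmod_two] at hsum hcoord ⊢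
  refine ⟨by lia, ?_⟩
  intro Q
  intros
  refine (mem_codeLattice_iff triplyOrthogonal_coord₄ Q).2 ⟨⟨Q (0, 0),
    ![Q (0, 1) - Q (0, 0), Q (0, 2) - Q (0, 0), Q (1, 0) - Q (0, 0),
      Q (2, 0) - Q (0, 0)], ?_⟩, ?_⟩
  · simp [Fin.forall_fin_succ, Fin.sum_univ_succ, coord₄, lowBit, highBit, intCast_one_zmod_two]
    and_intros <;> lia
  · simp [Fintype.sum_prod_type, Fin.forall_fin_succ, Fin.sum_univ_succ, coord₄, lowBit, highBit,
      intCast_one_zmod_two]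
    and_intros <;> lia

set_option maxHeartbeats 1000000 in
theorem halfHadamardMapsTo_coord₄_coord₂ :
    HalfHadamardMapsTo (codeLattice coord₄) (codeLattice coord₂) := by
  intro P hP
  obtain ⟨c, w, n, hn⟩ := exists_eq_of_mem_codeLattice triplyOrthogonal_coord₄ hP
  obtain ⟨-, hsum, hcoord⟩ := (mem_codeLattice_iff triplyOrthogonal_coord₄ P).1 hP
  simp [hn, hadamardSum, hadamard, Fin.forall_fin_succ, Fintype.sum_prod_type, Fin.sum_univ_succ,
    coord₄, lowBit, highBit, intCast_one_zmod_two] at hsum hcoord ⊢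
  refine ⟨by lia, ?_⟩
  intro Q
  intros
  refine (mem_codeLattice_iff triplyOrthogonal_coord₂ Q).2 ⟨⟨Q (0, 0),
    ![Q (0, 1) - Q (0, 0), Q (0, 2) - Q (0, 0)], ?_⟩, ?_⟩
  · simp [Fin.forall_fin_succ, Fin.sum_univ_succ, coord₂, lowBit, highBit, intCast_one_zmod_two]
    and_intros <;> lia
  · simp [Fintype.sum_prod_type, Fin.forall_fin_succ, Fin.sum_univ_succ, coord₂, lowBit, highBit,
      intCast_one_zmod_two]
    and_intros <;> lia

/-- The number of spanning `i`-tuples of a `j`-dimensional subspace over `𝔽₂`. -/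
theorem card_span_range_eq {V : Type} [AddCommGroup V] [Module (ZMod 2) V] [Finite V] {i j : ℕ}
    (hji : j ≤ i) (U : Submodule (ZMod 2) V) (hU : Module.finrank (ZMod 2) U = j) :
    Nat.card {v : Fin i → V // Submodule.span (ZMod 2) (Set.range v) = U} =
      ∏ k : Fin j, (2 ^ i - 2 ^ (k : ℕ)) := by
  have hb : Module.finrank (ZMod 2) (Fin j → ZMod 2) = Module.finrank (ZMod 2) U := by simp [hU]
  let c : (Fin j → ZMod 2) →ₗ[ZMod 2] V :=
    U.subtype ∘ₗ (LinearEquiv.ofFinrankEq _ _ hb).toLinearMap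
  have hc : Function.Injective c :=
    Subtype.val_injective.comp (LinearEquiv.ofFinrankEq _ _ hb).injective
  have hrange : Submodule.map c ⊤ = U := by
    rw [Submodule.map_comp, Submodule.map_top, LinearEquiv.range, Submodule.map_top,
      Submodule.range_subtype]
  have hspan : ∀ M : Matrix (Fin i) (Fin j) (ZMod 2),
      Submodule.span (ZMod 2) (Set.range fun r => c (M r)) = U ↔
        LinearIndependent (ZMod 2) M.col := by
    intro M
    have hM : (Set.range fun r => c (M r)) = c '' Set.range M.row := by
      rw [← Set.range_comp]
      rfl
    rw [hM, Submodule.span_image]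
    nth_rewrite 1 [← hrange]
    rw [(Submodule.map_injective_of_injective hc).eq_iff,
      linearIndependent_iff_card_eq_finrank_span, Set.finrank, ← Matrix.rank_eq_finrank_span_cols,
      M.rank_eq_finrank_span_row, Fintype.card_fin]
    refine ⟨fun h => ?_, fun h => Submodule.eq_top_of_finrank_eq ?_⟩
    · rw [h, finrank_top, Module.finrank_fin_fun]
    · rw [← h, Module.finrank_fin_fun]
  have hcard := card_linearIndependent (K := ZMod 2) (V := Fin i → ZMod 2) (k := j) (by simpa)
  simp only [ZMod.card, Module.finrank_fin_fun] at hcard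
  rw [← hcard]
  refine (Nat.card_eq_of_bijective (fun s : {s : Fin j → Fin i → ZMod 2 //
    LinearIndependent (ZMod 2) s} => ⟨fun r => c fun k => s.1 k r,
      (hspan (Matrix.of s.1).transpose).2 s.2⟩) ⟨fun s s' h => ?_, fun v => ?_⟩).symm
  · refine Subtype.ext (funext fun k => funext fun r => ?_)
    exact congrFun (hc (congrFun (congrArg Subtype.val h) r)) k
  · have hv : ∀ r, ∃ a, c a = v.1 r := fun r => by
      have : v.1 r ∈ Submodule.map c ⊤ := by
        rw [hrange]
        exact v.2.le (Submodule.subset_span ⟨r, rfl⟩)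
      obtain ⟨a, -, ha⟩ := this
      exact ⟨a, ha⟩
    choose a ha using hv
    have hva : (fun r => c (a r)) = v.1 := funext ha
    exact ⟨⟨fun k r => a r k, (hspan (Matrix.of a)).1 (hva ▸ v.2)⟩, Subtype.ext hva⟩

section AffineCosets

variable {ι : Type} [Fintype ι]

open Classical in
/-- The affine subspace through `m` with direction spanned by `v`. -/
def affineSpanFinset {i : ℕ} (m : Char2 ι) (v : Fin i → Char2 ι) : Finset (Char2 ι) :=
  Finset.univ.image fun a : Fin i → ZMod 2 => m + ∑ j, a j • v j

theorem coe_affineSpanFinset {i : ℕ} (m : Char2 ι) (v : Fin i → Char2 ι) :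
    (affineSpanFinset m v : Set (Char2 ι)) =
      (fun u => m + u) '' (Submodule.span (ZMod 2) (Set.range v) : Set (Char2 ι)) := by
  ext w
  simp only [affineSpanFinset, Finset.coe_image, Finset.coe_univ, Set.image_univ, Set.mem_range,
    Set.mem_image, SetLike.mem_coe, Submodule.mem_span_range_iff_exists_fun]
  constructor
  · rintro ⟨a, rfl⟩
    exact ⟨_, ⟨a, rfl⟩, rfl⟩
  · rintro ⟨_, ⟨a, rfl⟩, rfl⟩
    exact ⟨a, rfl⟩

theorem prod_affine_eq {i : ℕ} (f : Char2 ι → ℂ) (m : Char2 ι) (v : Fin i → Char2 ι) :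
    ∏ a : Fin i → ZMod 2, f (m + ∑ j, a j • v j) =
      (∏ w ∈ affineSpanFinset m v, f w) ^
        2 ^ (i - Module.finrank (ZMod 2) (Submodule.span (ZMod 2) (Set.range v))) := by
  classical
  let φ := Fintype.linearCombination (ZMod 2) v
  have hφ : ∀ a, φ a = ∑ j, a j • v j := fun a => Fintype.linearCombination_apply _ _ _
  have hker : Module.finrank (ZMod 2) (LinearMap.ker φ) =
      i - Module.finrank (ZMod 2) (Submodule.span (ZMod 2) (Set.range v)) := by
    have := φ.finrank_range_add_finrank_ker
    rw [Fintype.range_linearCombination, Module.finrank_fin_fun] at this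
    omega
  rw [Finset.prod_comp, ← Finset.prod_pow]
  refine Finset.prod_congr (by rw [affineSpanFinset]) fun b hb => ?_
  congr 1
  obtain ⟨a₀, -, rfl⟩ := Finset.mem_image.1 hb
  have hcard := Module.card_eq_pow_finrank (K := ZMod 2) (V := LinearMap.ker φ)
  rw [ZMod.card] at hcard
  rw [← hker, ← hcard, ← Fintype.card_subtype]
  refine Fintype.card_congr
    { toFun := fun a => ⟨a.1 - a₀, ?_⟩
      invFun := fun a => ⟨a.1 + a₀, ?_⟩
      left_inv := fun a => by simp
      right_inv := fun a => by simp }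
  · have := a.2
    simp only [← hφ, add_right_inj] at this
    simp [this]
  · have := a.2
    rw [LinearMap.mem_ker] at this
    rw [← hφ, ← hφ, map_add, this, zero_add]

theorem add_image_submodule_eq_iff {V : Type} [AddCommGroup V] [Module (ZMod 2) V]
    {x m : V} {U U' : Submodule (ZMod 2) V} :
    (fun u => m + u) '' (U' : Set V) = (fun u => x + u) '' (U : Set V) ↔
      m ∈ (fun u => x + u) '' (U : Set V) ∧ U' = U := by
  constructor
  · intro h
    have hm : m ∈ (fun u => x + u) '' (U : Set V) := h ▸ ⟨0, U'.zero_mem, add_zero m⟩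
    refine ⟨hm, ?_⟩
    obtain ⟨u₀, hu₀, rfl⟩ := hm
    ext u
    have := Set.ext_iff.1 h (x + u₀ + u)
    simpa [add_assoc, U.add_mem_iff_right hu₀] using this
  · rintro ⟨⟨u₀, hu₀, rfl⟩, rfl⟩
    ext w
    constructor
    · rintro ⟨u, hu, rfl⟩
      exact ⟨u₀ + u, U'.add_mem hu₀ hu, (add_assoc _ _ _).symm⟩
    · rintro ⟨u, hu, rfl⟩
      exact ⟨u - u₀, U'.sub_mem hu hu₀, by simp⟩

theorem card_affineSpanFinset_eq {i j : ℕ} (hji : j ≤ i) {W : Finset (Char2 ι)}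
    (hW : IsAffineCosetDim j W) (s : Finset (Char2 ι × (Fin i → Char2 ι)))
    (hs : ∀ mv, mv ∈ s ↔
      Module.finrank (ZMod 2) (Submodule.span (ZMod 2) (Set.range mv.2)) = j ∧
        affineSpanFinset mv.1 mv.2 = W) :
    s.card = 2 ^ j * ∏ k : Fin j, (2 ^ i - 2 ^ (k : ℕ)) := by
  classical
  obtain ⟨U, x, hU, hWU⟩ := hW
  have hiff : ∀ mv : Char2 ι × (Fin i → Char2 ι),
      (Module.finrank (ZMod 2) (Submodule.span (ZMod 2) (Set.range mv.2)) = j ∧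
        affineSpanFinset mv.1 mv.2 = W) ↔
      mv.1 ∈ W ∧ Submodule.span (ZMod 2) (Set.range mv.2) = U := by
    intro mv
    rw [← Finset.coe_inj, coe_affineSpanFinset, hWU, add_image_submodule_eq_iff, ← hWU,
      Finset.mem_coe]
    exact ⟨fun h => h.2, fun h => ⟨h.2 ▸ hU, h⟩⟩
  have hcardW : W.card = 2 ^ j := by
    rw [← Set.ncard_coe_finset, hWU, Set.ncard_image_of_injective _ (add_right_injective x),
      ← Nat.card_coe_set_eq, ← hU]
    exact (Module.natCard_eq_pow_finrank (K := ZMod 2)).trans (by simp)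
  have hprod : s = W ×ˢ Finset.univ.filter fun v : Fin i → Char2 ι =>
      Submodule.span (ZMod 2) (Set.range v) = U := by
    ext mv
    rw [hs, hiff, Finset.mem_product, Finset.mem_filter_univ]
  rw [hprod, Finset.card_product, ← card_span_range_eq hji U hU, Nat.card_eq_fintype_card,
    Fintype.card_subtype, hcardW]

/-- The sum of the products of theta constants over all parametrized affine subspaces. -/
def affineThetaSum {ι : Type} [Fintype ι] [DecidableEq ι] (i N : ℕ) (τ : Matrix ι ι ℂ) : ℂ :=
  ∑ m : Char2 ι, ∑ v : Fin i → Char2 ι,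
    (∏ a : Fin i → ZMod 2, thetaConst (m + ∑ j, a j • v j) τ) ^ 2 ^ N

theorem affineThetaSum_eq_sum_Sform [DecidableEq ι] (τ : Matrix ι ι ℂ) (i N : ℕ) :
    affineThetaSum i N τ =
      ∑ j ∈ Finset.range (i + 1), ((2 ^ j * ∏ k : Fin j, (2 ^ i - 2 ^ (k : ℕ)) : ℕ) : ℂ) *
        Sform ι j (2 ^ (i - j + N)) τ := by
  classical
  rw [affineThetaSum, ← Fintype.sum_prod_type' (f := fun m (v : Fin i → Char2 ι) =>
    (∏ a : Fin i → ZMod 2, thetaConst (m + ∑ j, a j • v j) τ) ^ 2 ^ N)]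
  have hrank : ∀ mv ∈ (Finset.univ : Finset (Char2 ι × (Fin i → Char2 ι))),
      Module.finrank (ZMod 2) (Submodule.span (ZMod 2) (Set.range mv.2)) ∈
        Finset.range (i + 1) := fun mv _ => by
    have := finrank_range_le_card (R := ZMod 2) mv.2
    rw [Fintype.card_fin] at this
    exact Finset.mem_range.2 (Nat.lt_succ_of_le this)
  rw [← Finset.sum_fiberwise_of_maps_to hrank]
  refine Finset.sum_congr rfl fun j hj => ?_
  have hcoset : ∀ mv ∈ Finset.univ.filter fun mv : Char2 ι × (Fin i → Char2 ι) =>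
      Module.finrank (ZMod 2) (Submodule.span (ZMod 2) (Set.range mv.2)) = j,
      affineSpanFinset mv.1 mv.2 ∈
        Finset.univ.filter fun W : Finset (Char2 ι) => IsAffineCosetDim j W := fun mv hmv =>
    Finset.mem_filter.2 ⟨Finset.mem_univ _, _, mv.1, (Finset.mem_filter.1 hmv).2,
      coe_affineSpanFinset _ _⟩
  rw [← Finset.sum_fiberwise_of_maps_to hcoset, Sform, Finset.mul_sum]
  refine Finset.sum_congr (Finset.ext fun W => ?_) fun W hW => ?_
  · simp only [Finset.mem_filter, Finset.mem_univ, true_and]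
  have hW' : IsAffineCosetDim j W := (Finset.mem_filter.1 hW).2
  rw [Finset.filter_filter, ← card_affineSpanFinset_eq
    (Nat.lt_succ_iff.1 (Finset.mem_range.1 hj)) hW' _ fun mv => Finset.mem_filter_univ mv,
    ← nsmul_eq_mul, ← Finset.sum_const]
  refine Finset.sum_congr rfl fun mv hmv => ?_
  obtain ⟨-, hr, hs⟩ := Finset.mem_filter.1 hmv
  rw [prod_affine_eq (fun w => thetaConst w τ), hr, hs, ← pow_mul, ← pow_add]

end AffineCosets

theorem prod_codeword_eq {ι X : Type} [Fintype ι] [Fintype X] {i N : ℕ} {g : X → Fin i → ZMod 2}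
    (hfib : ∀ a, (Finset.univ.filter fun x => g x = a).card = 2 ^ N) (τ : Matrix ι ι ℂ)
    (e d : ι → AffCoeff i) :
    ∏ x, thetaConst (fun k => codeword g (e k) x, fun k => codeword g (d k) x) τ =
      (∏ a : Fin i → ZMod 2, thetaConst ((fun k => (e k).1, fun k => (d k).1) +
        ∑ j, a j • ((fun k => (e k).2 j, fun k => (d k).2 j) : Char2 ι)) τ) ^ 2 ^ N := by
  rw [← Finset.prod_fiberwise Finset.univ g, ← Finset.prod_pow]
  refine Finset.prod_congr rfl fun a _ => ?_
  rw [← hfib a]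
  refine Finset.prod_eq_pow_card fun x hx => congrArg (thetaConst · τ) ?_
  rw [← (Finset.mem_filter.1 hx).2]
  ext k <;> simp [codeword, Prod.fst_sum, Prod.snd_sum]

/-- A pair of families of affine coefficients amounts to a characteristic and `i` directions. -/
def affCoeffEquiv (ι : Type) (i : ℕ) :
    (ι → AffCoeff i) × (ι → AffCoeff i) ≃ Char2 ι × (Fin i → Char2 ι) where
  toFun p := ((fun k => (p.1 k).1, fun k => (p.2 k).1),
    fun j => (fun k => (p.1 k).2 j, fun k => (p.2 k).2 j))
  invFun q := (fun k => (q.1.1 k, fun j => (q.2 j).1 k), fun k => (q.1.2 k, fun j => (q.2 j).2 k))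
  left_inv _ := rfl
  right_inv _ := rfl

theorem affineThetaSum_eq_latticeTheta {ι X : Type} [Fintype ι] [DecidableEq ι] [Fintype X]
    {τ : Matrix ι ι ℂ} (hτ : τ ∈ Siegel ι) {i N : ℕ} {g : X → Fin i → ZMod 2}
    (hg : TriplyOrthogonal g)
    (hfib : ∀ a, (Finset.univ.filter fun x => g x = a).card = 2 ^ N) :
    affineThetaSum i N τ = (2 ^ (i + 1)) ^ Fintype.card ι * latticeTheta τ (codeLattice g) := by
  have hsurj : Function.Surjective g := fun a => by
    obtain ⟨x, hx⟩ := Finset.card_pos.1 ((hfib a).symm ▸ Nat.two_pow_pos N)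
    exact ⟨x, (Finset.mem_filter.1 hx).2⟩
  rw [← sum_prod_thetaConst_eq_latticeTheta hτ hsurj hg, affineThetaSum,
    ← Fintype.sum_prod_type', ← Fintype.sum_prod_type']
  refine (Fintype.sum_equiv (affCoeffEquiv ι i) _ _ fun p => ?_).symm
  exact prod_codeword_eq hfib τ p.1 p.2

theorem affineThetaSum_eq_of_halfHadamard {ι : Type} [Fintype ι] [DecidableEq ι]
    {τ : Matrix ι ι ℂ} (hτ : τ ∈ Siegel ι) {i N M : ℕ} {g : Pt → Fin i → ZMod 2}
    {g' : Pt → Fin (i + 2) → ZMod 2} (hg : TriplyOrthogonal g) (hg' : TriplyOrthogonal g')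
    (hfib : ∀ a, (Finset.univ.filter fun x => g x = a).card = 2 ^ N)
    (hfib' : ∀ a, (Finset.univ.filter fun x => g' x = a).card = 2 ^ M)
    (h : HalfHadamardMapsTo (codeLattice g) (codeLattice g'))
    (h' : HalfHadamardMapsTo (codeLattice g') (codeLattice g)) :
    affineThetaSum (i + 2) M τ = 4 ^ Fintype.card ι * affineThetaSum i N τ := by
  rw [affineThetaSum_eq_latticeTheta hτ hg hfib, affineThetaSum_eq_latticeTheta hτ hg' hfib',
    latticeTheta_eq_of_halfHadamard τ h h', ← mul_assoc, ← mul_pow]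
  ring_nf

theorem affineThetaSum_two {ι : Type} [Fintype ι] [DecidableEq ι] {τ : Matrix ι ι ℂ}
    (hτ : τ ∈ Siegel ι) : affineThetaSum 2 2 τ = 4 ^ Fintype.card ι * affineThetaSum 0 4 τ :=
  affineThetaSum_eq_of_halfHadamard hτ triplyOrthogonal_coord₀ triplyOrthogonal_blockCoord₂
    (by decide) (by decide) halfHadamardMapsTo_coord₀_blockCoord₂
    halfHadamardMapsTo_blockCoord₂_coord₀

theorem affineThetaSum_three {ι : Type} [Fintype ι] [DecidableEq ι] {τ : Matrix ι ι ℂ}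
    (hτ : τ ∈ Siegel ι) : affineThetaSum 3 1 τ = 4 ^ Fintype.card ι * affineThetaSum 1 3 τ :=
  affineThetaSum_eq_of_halfHadamard hτ triplyOrthogonal_coord₁ triplyOrthogonal_coord₃
    (by decide) (by decide) halfHadamardMapsTo_coord₁_coord₃ halfHadamardMapsTo_coord₃_coord₁

theorem affineThetaSum_four {ι : Type} [Fintype ι] [DecidableEq ι] {τ : Matrix ι ι ℂ}
    (hτ : τ ∈ Siegel ι) : affineThetaSum 4 0 τ = 4 ^ Fintype.card ι * affineThetaSum 2 2 τ :=
  affineThetaSum_eq_of_halfHadamard hτ triplyOrthogonal_coord₂ triplyOrthogonal_coord₄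
    (by decide) (by decide) halfHadamardMapsTo_coord₂_coord₄ halfHadamardMapsTo_coord₄_coord₂

theorem affineThetaSum_zero {ι : Type} [Fintype ι] [DecidableEq ι] (N : ℕ) (τ : Matrix ι ι ℂ) :
    affineThetaSum 0 N τ = ∑ m : Char2 ι, thetaConst m τ ^ 2 ^ N := by
  simp [affineThetaSum]

theorem affineThetaSum_one {ι : Type} [Fintype ι] [DecidableEq ι] (N : ℕ) (τ : Matrix ι ι ℂ) :
    affineThetaSum 1 N τ = (∑ m : Char2 ι, thetaConst m τ ^ 2 ^ N) ^ 2 := by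
  rw [affineThetaSum, sq, Finset.sum_mul_sum]
  refine Finset.sum_congr rfl fun m _ => ?_
  refine Fintype.sum_equiv ((Equiv.funUnique (Fin 1) (Char2 ι)).trans (Equiv.addLeft m)) _ _
    fun v => ?_
  rw [← mul_pow, ← (Equiv.funUnique (Fin 1) (ZMod 2)).symm.prod_comp]
  congr 1
  refine (Fin.prod_univ_two _).trans ?_
  change thetaConst (m + ∑ j : Fin 1, (0 : ZMod 2) • v j) τ *
    thetaConst (m + ∑ j : Fin 1, (1 : ZMod 2) • v j) τ = _
  simp

theorem XiCosm_eq_of_mem_siegel {τ : Matrix (Fin 4) (Fin 4) ℂ} (hτ : τ ∈ Siegel (Fin 4)) :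
    XiCosm (Fin 4) τ = (12 / 7 : ℂ) * Fmod (Fin 4) τ := by
  have hzero := affineThetaSum_eq_sum_Sform τ 0 4
  have hone := affineThetaSum_eq_sum_Sform τ 1 3
  have htwo := affineThetaSum_eq_sum_Sform τ 2 2
  have hthree := affineThetaSum_eq_sum_Sform τ 3 1
  have hfour := affineThetaSum_eq_sum_Sform τ 4 0
  rw [affineThetaSum_four hτ] at hfour
  rw [affineThetaSum_three hτ] at hthree
  rw [affineThetaSum_two hτ] at htwo hfour
  rw [affineThetaSum_one] at hone hthree
  rw [affineThetaSum_zero] at hzero htwo hfour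
  simp only [Finset.sum_range_succ, Finset.sum_range_zero, Fin.prod_univ_succ, Fintype.card_fin]
    at hzero hone htwo hthree hfour
  norm_num at hzero hone htwo hthree hfour
  simp only [XiCosm, Fmod, Fintype.card_fin, Finset.sum_range_succ, Finset.sum_range_zero]
  norm_num
  linear_combination (-64 / 315 : ℂ) * hzero + (4 / 21 : ℂ) * hone - (1 / 18 : ℂ) * htwo +
    (1 / 168 : ℂ) * hthree - (1 / 5040 : ℂ) * hfour

/-- In genus 4 the cosmological constant `Ξ^{(4)}` is a rational multiple of the
Schottky form `F₄`; in fact `Ξ^{(4)} = (12/7)·F₄` on all of `ℍ₄`. -/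
theorem XiCosm_genus_four_eq_const_mul_F :
    (∃ c : ℚ, ∀ τ ∈ Siegel (Fin 4), XiCosm (Fin 4) τ = (c : ℂ) * Fmod (Fin 4) τ) ∧
    ∀ τ ∈ Siegel (Fin 4), XiCosm (Fin 4) τ = (12 / 7 : ℂ) * Fmod (Fin 4) τ := by
  exact ⟨⟨12 / 7, fun τ hτ => by rw [XiCosm_eq_of_mem_siegel hτ]; norm_num⟩,
    fun τ hτ => XiCosm_eq_of_mem_siegel hτ⟩
end
end
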